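/- Let n ≥ 1, ν > 0, let α₁, α₂ be constants with 1/(1+ν) ≤ α₁ ≤ α₂ and α₁ < 1, suppose n + 2α₁ − 2 > 0, let 0 < ε < 1, set A₁ = (2α₁(1−ε)(n+2α₁−2))^{−1/(1+ν)}, and let A₂ ≥ A₁. Suppose u₀ ∈ C(ℝⁿ) satisfies A₁(1+|x|²)^{α₁} ≤ u₀(x) ≤ A₂(1+|x|²)^{α₂} for all x ∈ ℝⁿ. Set b₁ = 2(n+2α₁−2)ε, and b₂ = 2n if α₂ ≤ 1 and b₂ = 2(n+2α₂−2) if α₂ > 1. Then there exists a solution u of the Cauchy problem u_t = Δu − u^{−ν} on ℝⁿ × (0,∞) with initial value u₀ which satisfies A₁(1+|x|²+b₁t)^{α₁} ≤ u(x,t) ≤ A₂(1+|x|²+b₂t)^{α₂} for all (x,t) ∈ ℝⁿ × (0,∞), and which satisfies the heat-kernel representation u(x,t) = ∫_{ℝⁿ} (4πt)^{−n/2} e^{−|x−y|²/(4t)} u₀(y) dy − ∫₀ᵗ ∫_{ℝⁿ} (4π(t−s))^{−n/2} e^{−|x−y|²/(4(t−s))} u(y,s)^{−ν} dy ds for all x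 ∈ ℝⁿ and t > 0. -/

import Mathlib

open MeasureTheory Real Set Filter Topology Metric

noncomputable section

/-- Euclidean space `ℝⁿ`. -/
abbrev E (n : ℕ) := EuclideanSpace ℝ (Fin n)

/-- Second partial derivative `∂²f/∂xᵢ∂xⱼ` of `f : ℝⁿ → ℝ`. -/
def pd2 {n : ℕ} (f : E n → ℝ) (i j : Fin n) (x : E n) : ℝ :=
  fderiv ℝ (fun y => fderiv ℝ f y (EuclideanSpace.single j (1 : ℝ))) x
    (EuclideanSpace.single i (1 : ℝ))

/-- Spatial Laplacian of `f : ℝⁿ → ℝ`. -/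
def lap {n : ℕ} (f : E n → ℝ) (x : E n) : ℝ := ∑ i, pd2 f i i x

/-- `u = u(x,t)` is of class `C^{2,1}` on a set `S ⊆ ℝⁿ × ℝ`: `u`, `∂u/∂t` and
all first and second spatial derivatives are continuous on `S`. -/
structure IsC21 {n : ℕ} (S : Set (E n × ℝ)) (u : E n → ℝ → ℝ) : Prop where
  cont : ContinuousOn (fun p : E n × ℝ => u p.1 p.2) S
  cont_t : ContinuousOn (fun p : E n × ℝ => deriv (u p.1) p.2) S
  cont_x : ∀ i : Fin n, ContinuousOn
    (fun p : E n × ℝ =>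
      fderiv ℝ (fun y => u y p.2) p.1 (EuclideanSpace.single i (1 : ℝ))) S
  cont_xx : ∀ i j : Fin n, ContinuousOn
    (fun p : E n × ℝ => pd2 (fun y => u y p.2) i j p.1) S

/-- A solution of the Cauchy problem `u_t = Δu - u^{-ν}` on `ℝⁿ × (0,T)` with
initial value `u₀`. -/
structure IsCauchySol (n : ℕ) (ν T : ℝ) (u₀ : E n → ℝ) (u : E n → ℝ → ℝ) : Prop where
  pos : ∀ (x : E n), ∀ t ∈ Ioo (0 : ℝ) T, 0 < u x t
  reg : IsC21 ((univ : Set (E n)) ×ˢ Ioo (0 : ℝ) T) u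
  eqn : ∀ (x : E n), ∀ t ∈ Ioo (0 : ℝ) T,
    deriv (u x) t = lap (fun y => u y t) x - u x t ^ (-ν)
  init : ∀ K : Set (E n), IsCompact K →
    Tendsto (fun t => ∫ x in K, |u x t - u₀ x|) (𝓝[>] (0 : ℝ)) (𝓝 0)
  bound : ∀ δ ∈ Ioo (0 : ℝ) T, ∃ C₁ C₂ : ℝ, 0 < C₁ ∧ 0 < C₂ ∧
    ∀ (x : E n), ∀ t ∈ Ioo (0 : ℝ) (T - δ),
      C₁ * (1 + ‖x‖ ^ 2) ^ (-(1 / (1 + ν))) ≤ u x t ∧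
      u x t ≤ C₂ * Real.exp (C₂ * ‖x‖ ^ 2)

/-- A solution of the Cauchy problem on `ℝⁿ × (0,∞)`: a solution on `ℝⁿ × (0,T)`
for every `T > 0`. -/
def IsGlobalSol (n : ℕ) (ν : ℝ) (u₀ : E n → ℝ) (u : E n → ℝ → ℝ) : Prop :=
  ∀ T > (0 : ℝ), IsCauchySol n ν T u₀ u

/-- The heat kernel on `ℝⁿ`. -/
def heatKernel (n : ℕ) (t : ℝ) (z : E n) : ℝ :=
  (4 * π * t) ^ (-(n : ℝ) / 2) * Real.exp (-‖z‖ ^ 2 / (4 * t))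

/-- `u` satisfies the heat-kernel (Duhamel) representation formula for the
equation `u_t = Δu - u^{-ν}` on `ℝⁿ × (0,T)`. -/
def HeatRepr (n : ℕ) (ν T : ℝ) (u₀ : E n → ℝ) (u : E n → ℝ → ℝ) : Prop :=
  ∀ (x : E n), ∀ t ∈ Ioo (0 : ℝ) T,
    u x t = (∫ y : E n, heatKernel n t (x - y) * u₀ y) -
      ∫ s in Ioo (0 : ℝ) t, ∫ y : E n, heatKernel n (t - s) (x - y) * u y s ^ (-ν)

set_option linter.unusedSectionVars false

section
/-! ### Gaussian basics -/

def gam (n : ℕ) (z : E n) : ℝ := (4 * π) ^ (-(n : ℝ) / 2) * Real.exp (-‖z‖ ^ 2 / 4)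

lemma gam_pos (n : ℕ) (z : E n) : 0 < gam n z := by
  unfold gam; positivity

lemma gam_cont (n : ℕ) : Continuous (gam n) := by
  unfold gam; fun_prop

lemma integral_gam (n : ℕ) : ∫ z, gam n z = 1 := by
  unfold gam
  rw [integral_const_mul]
  have h := GaussianFourier.integral_rexp_neg_mul_sq_norm (V := E n) (b := 1/4) (by norm_num)
  have h2 : (fun v : E n => rexp (-‖v‖^2/4)) = fun v => rexp (-(1/4) * ‖v‖^2) := by
    ext v; congr 1; ring
  rw [h2, h, finrank_euclideanSpace_fin, show π / (1/4) = 4 * π by ring, ← Real.rpow_add (by positivity)]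
  simp [neg_div]

/-- rapid (super-exponential) decay -/
def AD {n : ℕ} {F : Type*} [NormedAddCommGroup F] (η : E n → F) : Prop :=
  ∀ a : ℝ, ∃ C, 0 ≤ C ∧ ∀ z, ‖η z‖ ≤ C * Real.exp (-(a * ‖z‖))

lemma AD_gam (n : ℕ) : AD (gam n) := by
  intro a
  refine ⟨(4 * π) ^ (-(n : ℝ) / 2) * Real.exp (a^2), by positivity, fun z => ?_⟩
  rw [Real.norm_eq_abs, abs_of_pos (gam_pos n z), gam, mul_assoc, ← Real.exp_add]
  gcongr
  nlinarith [sq_nonneg (‖z‖/2 - a)]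

lemma AD.mono {n : ℕ} {F G : Type*} [NormedAddCommGroup F] [NormedAddCommGroup G]
    {η : E n → F} {ζ : E n → G} (h : AD η) (c b : ℝ) (hc : 0 ≤ c)
    (hb : ∀ z, ‖ζ z‖ ≤ c * Real.exp (b * ‖z‖) * ‖η z‖) : AD ζ := by
  intro a
  obtain ⟨C, hC, h1⟩ := h (a + b)
  refine ⟨c * C, by positivity, fun z => (hb z).trans ?_⟩
  calc _ ≤ c * Real.exp (b * ‖z‖) * (C * Real.exp (-((a+b) * ‖z‖))) := by gcongr; exact h1 z
    _ = c * C * (Real.exp (b * ‖z‖) * Real.exp (-((a+b) * ‖z‖))) := by ring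
    _ = _ := by rw [← Real.exp_add]; ring_nf

lemma AD.add {n : ℕ} {F : Type*} [NormedAddCommGroup F]
    {η ζ : E n → F} (h : AD η) (h' : AD ζ) : AD (fun z => η z + ζ z) := by
  intro a
  obtain ⟨C, hC, h1⟩ := h a
  obtain ⟨C', hC', h1'⟩ := h' a
  refine ⟨C + C', by positivity, fun z => (norm_add_le _ _).trans ?_⟩
  rw [add_mul]; exact add_le_add (h1 z) (h1' z)

lemma integrable_exp_neg_norm (n : ℕ) : Integrable (fun z : E n => Real.exp (-‖z‖)) := by
  have h := integrable_one_add_norm (E := E n) (μ := volume) (r := n + 1)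
    (by rw [finrank_euclideanSpace_fin]; linarith)
  have h2 := h.const_mul ((n+1).factorial * Real.exp 1)
  refine h2.mono' (by fun_prop) (ae_of_all _ fun z => ?_)
  rw [Real.norm_eq_abs, abs_of_pos (Real.exp_pos _)]
  have h3 := Real.pow_div_factorial_le_exp (1 + ‖z‖) (by positivity) (n+1)
  rw [div_le_iff₀ (by positivity)] at h3
  rw [Real.rpow_neg (by positivity), show ((n:ℝ)+1) = ((n+1 : ℕ):ℝ) by push_cast; ring,
    Real.rpow_natCast, ← div_eq_mul_inv, le_div_iff₀ (by positivity), Real.exp_neg]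
  rw [Real.exp_add] at h3
  have := Real.exp_pos ‖z‖
  calc _ ≤ (rexp ‖z‖)⁻¹ * (rexp 1 * rexp ‖z‖ * ((n+1).factorial)) := by gcongr
    _ = _ := by field_simp

lemma norm_le_exp_norm {V : Type*} [NormedAddCommGroup V] (z : V) : ‖z‖ ≤ Real.exp ‖z‖ := by
  linarith [Real.add_one_le_exp ‖z‖]

/-- exponential growth bound -/
def EB {n : ℕ} (C κ : ℝ) (h : E n → ℝ) : Prop := ∀ y, |h y| ≤ C * Real.exp (κ * ‖y‖)

lemma EB.shift {n : ℕ} {C κ : ℝ} {h : E n → ℝ} (hb : EB C κ h) (hκ : 0 ≤ κ) {R r : ℝ} (hr : |r| ≤ R)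
    (x z : E n) : |h (x + r • z)| ≤ C * Real.exp (κ * ‖x‖) * Real.exp (κ * R * ‖z‖) := by
  have hC : 0 ≤ C := by
    have := (abs_nonneg _).trans (hb 0)
    simpa using this
  refine (hb _).trans ?_
  rw [mul_assoc, ← Real.exp_add]
  gcongr
  have : ‖x + r • z‖ ≤ ‖x‖ + R * ‖z‖ := by
    refine (norm_add_le _ _).trans ?_
    rw [norm_smul, Real.norm_eq_abs]; gcongr
  calc κ * ‖x + r • z‖ ≤ κ * (‖x‖ + R * ‖z‖) := by gcongr
    _ = _ := by ring

section
variable {n : ℕ} {F : Type*} [NormedAddCommGroup F] [NormedSpace ℝ F]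

lemma AD.integrable_exp {η : E n → F} (had : AD η) (hη : Continuous η) (a : ℝ) :
    Integrable (fun z => Real.exp (a * ‖z‖) * ‖η z‖) := by
  obtain ⟨C, hC, h1⟩ := had (a + 1)
  refine ((integrable_exp_neg_norm n).const_mul C).mono' (by fun_prop) (ae_of_all _ fun z => ?_)
  rw [Real.norm_eq_abs, abs_of_nonneg (by positivity)]
  calc _ ≤ Real.exp (a * ‖z‖) * (C * Real.exp (-((a+1) * ‖z‖))) := by gcongr; exact h1 z
    _ = C * (Real.exp (a * ‖z‖) * Real.exp (-((a+1) * ‖z‖))) := by ring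
    _ = _ := by rw [← Real.exp_add]; ring_nf

/-- averaged integral -/
def Iav (η : E n → F) (h : E n → ℝ) (x : E n) (r : ℝ) : F := ∫ z, h (x + r • z) • η z

lemma integrable_Iav {η : E n → F} (had : AD η) (hη : Continuous η) {h : E n → ℝ}
    (hh : Continuous h) {C κ : ℝ} (hκ : 0 ≤ κ) (hb : EB C κ h) (x : E n) (r : ℝ) :
    Integrable (fun z => h (x + r • z) • η z) := by
  refine ((had.integrable_exp hη (κ * |r|)).const_mul (C * Real.exp (κ * ‖x‖))).mono'
    (by fun_prop) (ae_of_all _ fun z => ?_)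
  rw [norm_smul, Real.norm_eq_abs, ← mul_assoc]
  gcongr
  exact hb.shift hκ le_rfl x z

lemma norm_Iav_le {η : E n → F} (had : AD η) (hη : Continuous η) {h : E n → ℝ}
    {C κ R : ℝ} (hκ : 0 ≤ κ) (hb : EB C κ h) (x : E n) {r : ℝ} (hr : |r| ≤ R) :
    ‖Iav η h x r‖ ≤ C * Real.exp (κ * ‖x‖) * ∫ z, Real.exp (κ * R * ‖z‖) * ‖η z‖ := by
  rw [← integral_const_mul]
  refine norm_integral_le_of_norm_le ((had.integrable_exp hη (κ * R)).const_mul _)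
    (ae_of_all _ fun z => ?_)
  rw [norm_smul, Real.norm_eq_abs, ← mul_assoc]
  gcongr
  exact hb.shift hκ hr x z

/-- spatial derivative falls on the kernel -/
lemma hasFDerivAt_Iav {η : E n → ℝ} {η' : E n → E n →L[ℝ] ℝ} (had : AD η) (had' : AD η')
    (hη' : Continuous η') (hd : ∀ z, HasFDerivAt η (η' z) z) {h : E n → ℝ}
    (hh : Continuous h) {C κ : ℝ} (hκ : 0 ≤ κ) (hb : EB C κ h) (x₀ : E n) {r : ℝ} (hr : 0 < r) :
    HasFDerivAt (fun x => Iav η h x r) (-(r⁻¹) • Iav η' h x₀ r) x₀ := by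
  have hη : Continuous η := continuous_iff_continuousAt.2 fun z => (hd z).continuousAt
  have e1 : (fun x => Iav η h x r) = fun x => ∫ z, h (x₀ + r • z) • η (z - r⁻¹ • (x - x₀)) := by
    ext x
    rw [Iav, ← integral_sub_right_eq_self _ (r⁻¹ • (x - x₀))]
    refine integral_congr_ae (ae_of_all _ fun z => ?_)
    simp only
    congr 2
    rw [smul_sub, smul_smul, mul_inv_cancel₀ hr.ne', one_smul]; abel
  obtain ⟨C', hC', h1⟩ := had' (κ * r + 1)
  have hC : 0 ≤ C := by
    have := (abs_nonneg _).trans (hb 0)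
    simpa using this
  rw [e1]
  have key := hasFDerivAt_integral_of_dominated_of_fderiv_le (μ := (volume : Measure (E n)))
    (F := fun x z => h (x₀ + r • z) • η (z - r⁻¹ • (x - x₀)))
    (F' := fun x z => h (x₀ + r • z) • (-(r⁻¹)) • η' (z - r⁻¹ • (x - x₀)))
    (s := ball x₀ r) (x₀ := x₀)
    (bound := fun z => (C * Real.exp (κ * ‖x₀‖) * r⁻¹ * C' * Real.exp (|κ * r + 1|)) * Real.exp (-‖z‖))
    (ball_mem_nhds _ hr)
    (Eventually.of_forall fun x => by fun_prop)
    (by simpa using integrable_Iav had hη hh hκ hb x₀ r)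
    (by fun_prop)
    (ae_of_all _ fun z x hx => ?_)
    ((integrable_exp_neg_norm n).const_mul _)
    (ae_of_all _ fun z x hx => ?_)
  · refine key.congr_fderiv ?_
    rw [Iav, ← integral_smul]
    refine integral_congr_ae (ae_of_all _ fun z => ?_)
    simp [smul_smul, mul_comm]
  · rw [norm_smul, norm_smul, norm_neg, norm_inv, Real.norm_eq_abs, Real.norm_eq_abs, abs_of_pos hr]
    have h2 := hb.shift hκ (R := r) (r := r) (by rw [abs_of_pos hr]) x₀ z
    have h3 : ‖r⁻¹ • (x - x₀)‖ ≤ 1 := by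
      rw [norm_smul, norm_inv, Real.norm_eq_abs, abs_of_pos hr, inv_mul_le_iff₀ hr, mul_one]
      rw [mem_ball_iff_norm] at hx; exact hx.le
    have h4 : ‖z‖ - 1 ≤ ‖z - r⁻¹ • (x - x₀)‖ := by
      have := norm_sub_norm_le z (r⁻¹ • (x - x₀)); linarith
    have hp : 0 ≤ κ * r + 1 := by positivity
    calc _ ≤ (C * Real.exp (κ * ‖x₀‖) * Real.exp (κ * r * ‖z‖)) * (r⁻¹ * (C' * Real.exp (-((κ * r + 1) * (‖z‖ - 1))))) := by
          gcongr
          refine (h1 _).trans ?_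
          gcongr
      _ = (C * Real.exp (κ * ‖x₀‖) * r⁻¹ * C') * (Real.exp (κ * r * ‖z‖) * Real.exp (-((κ * r + 1) * (‖z‖ - 1)))) := by ring
      _ = (C * Real.exp (κ * ‖x₀‖) * r⁻¹ * C') * (Real.exp (|κ * r + 1|) * Real.exp (-‖z‖)) := by
          rw [← Real.exp_add, ← Real.exp_add, abs_of_nonneg hp]; ring_nf
      _ = _ := by ring
  · have h5 : HasFDerivAt (fun x => z - r⁻¹ • (x - x₀)) (-(r⁻¹ • ContinuousLinearMap.id ℝ (E n))) x :=
      (((hasFDerivAt_id x).sub_const x₀).const_smul r⁻¹).const_sub z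
    have h6 := ((hd _).comp x h5).const_smul (h (x₀ + r • z))
    refine HasFDerivAt.congr_fderiv (f := fun x => h (x₀ + r • z) • η (z - r⁻¹ • (x - x₀))) h6 ?_
    ext v
    simp

end

end

section
abbrev ee {n : ℕ} (i : Fin n) : E n := EuclideanSpace.single i (1 : ℝ)

lemma EB.C_nonneg {n : ℕ} {C κ : ℝ} {h : E n → ℝ} (hb : EB C κ h) : 0 ≤ C := by
  have := (abs_nonneg _).trans (hb 0)
  simpa using this

lemma abs_coord_le {n : ℕ} (z : E n) (i : Fin n) : |z i| ≤ ‖z‖ := by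
  simpa using EuclideanSpace.norm_eq z ▸ PiLp.norm_apply_le z i

lemma clm_sum {n : ℕ} (L : E n →L[ℝ] ℝ) (z : E n) : L z = ∑ i, z i * L (ee i) := by
  have h : z = ∑ i, z i • ee i := by
    have := (EuclideanSpace.basisFun (Fin n) ℝ).sum_repr z
    simpa using this.symm
  conv_lhs => rw [h]
  simp [map_sum]

section
variable {n : ℕ}

lemma AD.apply {η' : E n → E n →L[ℝ] ℝ} (h : AD η') (v : E n) : AD (fun z => η' z v) := by
  refine h.mono ‖v‖ 0 (norm_nonneg _) fun z => ?_
  simpa [mul_comm] using (η' z).le_opNorm v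

lemma AD.apply_self {η' : E n → E n →L[ℝ] ℝ} (h : AD η') : AD (fun z => η' z z) := by
  refine h.mono 1 1 zero_le_one fun z => ?_
  refine ((η' z).le_opNorm z).trans ?_
  rw [mul_comm, one_mul, one_mul]
  gcongr
  exact norm_le_exp_norm z

lemma AD.const_mul {η : E n → ℝ} (h : AD η) (c : ℝ) : AD (fun z => c * η z) := by
  refine h.mono |c| 0 (abs_nonneg _) fun z => ?_
  simp

lemma AD.coord_mul {η : E n → ℝ} (h : AD η) (i : Fin n) : AD (fun z => z i * η z) := by
  refine h.mono 1 1 zero_le_one fun z => ?_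
  rw [norm_mul, one_mul, one_mul]
  gcongr
  exact (abs_coord_le z i).trans (norm_le_exp_norm z)

/-- derivative in the scale falls on the kernel -/
lemma hasDerivAt_Iav_scale {η : E n → ℝ} {η' : E n → E n →L[ℝ] ℝ} (had : AD η) (had' : AD η')
    (hη' : Continuous η') (hd : ∀ z, HasFDerivAt η (η' z) z) {h : E n → ℝ}
    (hh : Continuous h) {C κ : ℝ} (hκ : 0 ≤ κ) (hb : EB C κ h) (x : E n) {r₀ : ℝ} (hr : 0 < r₀) :
    HasDerivAt (fun r => Iav η h x r)
      (-(r₀⁻¹) * (n * Iav η h x r₀ + Iav (fun z => η' z z) h x r₀)) r₀ := by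
  have hη : Continuous η := continuous_iff_continuousAt.2 fun z => (hd z).continuousAt
  obtain ⟨C', hC', h1⟩ := had' (2 * (κ * r₀ + 2))
  have hC := hb.C_nonneg
  have key := (hasDerivAt_integral_of_dominated_loc_of_deriv_le (μ := (volume : Measure (E n)))
    (F := fun (l : ℝ) z => h (x + r₀ • z) • η (l • z))
    (F' := fun (l : ℝ) z => h (x + r₀ • z) • (η' (l • z) z))
    (s := ball (1:ℝ) (1/2)) (x₀ := (1:ℝ))
    (bound := fun z => (C * Real.exp (κ * ‖x‖) * C') * Real.exp (-‖z‖))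
    (ball_mem_nhds _ (by norm_num))
    (Eventually.of_forall fun x => by fun_prop)
    (by simpa using integrable_Iav had hη hh hκ hb x r₀)
    (by fun_prop)
    (ae_of_all _ fun z l hl => ?_)
    ((integrable_exp_neg_norm n).const_mul _)
    (ae_of_all _ fun z l hl => ?_)).2
  · have hl : HasDerivAt (fun r : ℝ => r₀ / r) (-(r₀⁻¹)) r₀ := by
      have := (hasDerivAt_inv hr.ne').const_mul r₀
      simp only [div_eq_mul_inv]
      refine HasDerivAt.congr_deriv this ?_
      field_simp
    have h10 : r₀ / r₀ = 1 := div_self hr.ne'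
    rw [← h10] at key
    have k2 := HasDerivAt.comp (h₂ := fun l : ℝ => ∫ z, h (x + r₀ • z) • η (l • z)) r₀ key hl
    have k3 := (hl.pow n).mul k2
    have e1 : (fun r => Iav η h x r) =ᶠ[𝓝 r₀] fun r => (r₀ / r) ^ n * ∫ z, h (x + r₀ • z) • η ((r₀ / r) • z) := by
      filter_upwards [lt_mem_nhds hr] with r hr'
      have hlp : 0 < r₀ / r := by positivity
      have := Measure.integral_comp_smul (volume : Measure (E n)) (fun z => h (x + r • z) • η z) (r₀ / r)
      rw [finrank_euclideanSpace_fin, abs_of_pos (by positivity)] at this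
      have e2 : (fun z : E n => h (x + r₀ • z) • η ((r₀ / r) • z)) = fun z => h (x + r • (r₀ / r) • z) • η ((r₀ / r) • z) := by
        ext z
        rw [smul_smul, mul_div_cancel₀ _ hr'.ne']
      rw [e2, this, Iav, smul_eq_mul, ← mul_assoc, mul_inv_cancel₀ (by positivity), one_mul]
    refine HasDerivAt.congr_of_eventuallyEq ?_ e1
    refine HasDerivAt.congr_deriv (f := fun r => (r₀ / r) ^ n * ∫ z, h (x + r₀ • z) • η ((r₀ / r) • z)) k3 ?_
    simp only [h10, one_pow, one_smul, Iav, Function.comp, mul_one, one_mul, Pi.pow_apply]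
    ring
  · rw [norm_smul, Real.norm_eq_abs]
    have h2 := hb.shift hκ (R := r₀) (r := r₀) (by rw [abs_of_pos hr]) x z
    rw [mem_ball, Real.dist_eq, abs_lt] at hl
    have h3 : ‖η' (l • z) z‖ ≤ C' * Real.exp (-((κ * r₀ + 2) * ‖z‖)) * Real.exp ‖z‖ := by
      refine ((η' (l • z)).le_opNorm z).trans ?_
      gcongr
      · refine (h1 _).trans ?_
        refine mul_le_mul_of_nonneg_left (Real.exp_le_exp.2 ?_) hC'
        rw [norm_smul, Real.norm_eq_abs, abs_of_pos (by linarith)]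
        have : 0 ≤ (κ * r₀ + 2) * ‖z‖ := by positivity
        nlinarith
      · exact norm_le_exp_norm z
    calc _ ≤ (C * Real.exp (κ * ‖x‖) * Real.exp (κ * r₀ * ‖z‖)) * (C' * Real.exp (-((κ * r₀ + 2) * ‖z‖)) * Real.exp ‖z‖) := by
          gcongr
      _ = (C * Real.exp (κ * ‖x‖) * C') * (Real.exp (κ * r₀ * ‖z‖) * Real.exp (-((κ * r₀ + 2) * ‖z‖)) * Real.exp ‖z‖) := by ring
      _ = _ := by
          rw [← Real.exp_add, ← Real.exp_add]; ring_nf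
  · have h5 : HasDerivAt (fun l : ℝ => l • z) z l := by
      simpa using (hasDerivAt_id l).smul_const z
    exact ((hd (l • z)).comp_hasDerivAt l h5).const_smul (h (x + r₀ • z))

/-- derivative in the scale falls on the function -/
lemma hasDerivAt_Iav_scale' {η : E n → ℝ} (had : AD η) (hη : Continuous η) {f : E n → ℝ}
    {f' : E n → E n →L[ℝ] ℝ} (hf : ∀ y, HasFDerivAt f (f' y) y) (hf' : Continuous f')
    {C κ : ℝ} (hκ : 0 ≤ κ) (hb : EB C κ f) (hb' : EB C κ (fun y => ‖f' y‖)) (x : E n) (r₀ : ℝ) :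
    HasDerivAt (fun r => Iav η f x r)
      (∑ i, Iav (fun z => z i * η z) (fun y => f' y (ee i)) x r₀) r₀ := by
  have hfc : Continuous f := continuous_iff_continuousAt.2 fun z => (hf z).continuousAt
  have hC := hb.C_nonneg
  have hbi : ∀ i, EB C κ (fun y => f' y (ee i)) := fun i y => by
    refine le_trans ?_ (hb' y)
    rw [abs_of_nonneg (norm_nonneg _)]
    simpa using (f' y).le_opNorm (ee i)
  have key := (hasDerivAt_integral_of_dominated_loc_of_deriv_le (μ := (volume : Measure (E n)))
    (F := fun (r : ℝ) z => f (x + r • z) • η z)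
    (F' := fun (r : ℝ) z => (f' (x + r • z) z) • η z)
    (s := ball r₀ 1) (x₀ := r₀)
    (bound := fun z => (C * Real.exp (κ * ‖x‖)) * (Real.exp ((κ * (|r₀| + 1) + 1) * ‖z‖) * ‖η z‖))
    (ball_mem_nhds _ (by norm_num))
    (Eventually.of_forall fun x => by fun_prop)
    (by simpa using integrable_Iav had hη hfc hκ hb x r₀)
    (by fun_prop)
    (ae_of_all _ fun z l hl => ?_)
    ((had.integrable_exp hη _).const_mul _)
    (ae_of_all _ fun z l hl => ?_)).2
  · refine key.congr_deriv ?_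
    simp only [Iav]
    rw [← integral_finsetSum]
    · refine integral_congr_ae (ae_of_all _ fun z => ?_)
      simp only
      rw [clm_sum, Finset.sum_smul]
      refine Finset.sum_congr rfl fun i _ => ?_
      simp; ring
    · intro i _
      exact integrable_Iav (had.coord_mul i) (by fun_prop) (by fun_prop) hκ (hbi i) x r₀
  · rw [norm_smul]
    have hl' : |l| ≤ |r₀| + 1 := by
      rw [mem_ball, Real.dist_eq] at hl
      have := abs_sub_abs_le_abs_sub l r₀; linarith
    have h2 := hb'.shift hκ hl' x z
    rw [abs_of_nonneg (norm_nonneg _)] at h2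
    have h3 := (f' (x + l • z)).le_opNorm z
    calc _ ≤ ((C * Real.exp (κ * ‖x‖) * Real.exp (κ * (|r₀| + 1) * ‖z‖)) * Real.exp ‖z‖) * ‖η z‖ := by
          gcongr
          refine h3.trans ?_
          gcongr
          exact norm_le_exp_norm z
      _ = (C * Real.exp (κ * ‖x‖)) * ((Real.exp (κ * (|r₀| + 1) * ‖z‖) * Real.exp ‖z‖) * ‖η z‖) := by ring
      _ = _ := by rw [← Real.exp_add]; ring_nf
  · have h5 : HasDerivAt (fun l : ℝ => x + l • z) z l := by
      simpa using ((hasDerivAt_id l).smul_const z).const_add x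
    exact ((hf _).comp_hasDerivAt l h5).smul_const (η z)

/-- integration by parts -/
lemma Iav_ibp {η : E n → ℝ} {η' : E n → E n →L[ℝ] ℝ} (had : AD η) (had' : AD η')
    (hη' : Continuous η') (hd : ∀ z, HasFDerivAt η (η' z) z) {f : E n → ℝ}
    {f' : E n → E n →L[ℝ] ℝ} (hf : ∀ y, HasFDerivAt f (f' y) y) (hf' : Continuous f')
    {C κ : ℝ} (hκ : 0 ≤ κ) (hb : EB C κ f) (hb' : EB C κ (fun y => ‖f' y‖)) (x : E n) (r : ℝ)
    (i : Fin n) :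
    Iav (fun z => η' z (ee i)) f x r = - (r * Iav η (fun y => f' y (ee i)) x r) := by
  have hη : Continuous η := continuous_iff_continuousAt.2 fun z => (hd z).continuousAt
  have hfc : Continuous f := continuous_iff_continuousAt.2 fun z => (hf z).continuousAt
  have hbi : EB C κ (fun y => f' y (ee i)) := fun y => by
    refine le_trans ?_ (hb' y)
    rw [abs_of_nonneg (norm_nonneg _)]
    simpa using (f' y).le_opNorm (ee i)
  have hd2 : ∀ z, HasFDerivAt (fun z => f (x + r • z)) (r • f' (x + r • z)) z := fun z => by
    have h5 : HasFDerivAt (fun z : E n => x + r • z) (r • ContinuousLinearMap.id ℝ (E n)) z := by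
      simpa using ((hasFDerivAt_id z).const_smul r).const_add x
    refine ((hf _).comp z h5).congr_fderiv ?_
    ext v; simp
  have key := integral_bilinear_hasFDerivAt_right_eq_neg_left_of_integrable
    (μ := (volume : Measure (E n))) (f := fun z => f (x + r • z))
    (f' := fun z => r • f' (x + r • z)) (g := η) (g' := η') (v := ee i)
    (B := ContinuousLinearMap.mul ℝ ℝ)
    (by
      have := (integrable_Iav had hη (h := fun y => f' y (ee i)) (by fun_prop) hκ hbi x r).const_mul r
      simpa [mul_assoc] using this)
    (by simpa using integrable_Iav (had'.apply (ee i)) (by fun_prop) hfc hκ hb x r)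
    (by simpa using integrable_Iav had hη hfc hκ hb x r)
    (fun z _ => hd2 z) (fun z _ => hd z)
  simp only [ContinuousLinearMap.mul_apply'] at key
  simp only [Iav, smul_eq_mul]
  rw [key, ← integral_const_mul]
  simp [mul_assoc]

/-! derivatives of the Gaussian -/

def gamD (n : ℕ) (z : E n) : E n →L[ℝ] ℝ := (-(1/2) * gam n z) • innerSL ℝ z

lemma hasFDerivAt_gam (z : E n) : HasFDerivAt (gam n) (gamD n z) z := by
  have h1 : HasFDerivAt (fun z : E n => ‖z‖^2) (2 • innerSL ℝ z) z := (hasStrictFDerivAt_norm_sq z).hasFDerivAt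
  have h2 : HasFDerivAt (fun z : E n => -‖z‖^2/4) ((-(1/2) : ℝ) • innerSL ℝ z) z := by
    have := h1.const_mul (-(1/4) : ℝ)
    refine (this.congr_fderiv ?_).congr_of_eventuallyEq (Eventually.of_forall fun z => ?_)
    · ext v; simp; ring
    · simp; ring
  have h3 := h2.exp.const_mul ((4 * π) ^ (-(n : ℝ) / 2))
  refine HasFDerivAt.congr_fderiv (f := gam n) h3 ?_
  ext v; simp [gamD, gam]; ring

lemma gamD_cont : Continuous (gamD n) := by
  unfold gamD
  have := gam_cont n
  fun_prop

lemma AD_gamD : AD (gamD n) := by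
  refine (AD_gam n).mono 1 1 zero_le_one fun z => ?_
  rw [gamD, norm_smul, innerSL_apply_norm, norm_mul, one_mul, one_mul]
  have h1 := norm_le_exp_norm z
  have h0 : ‖(-(1/2) : ℝ)‖ ≤ 1 := by norm_num
  calc _ ≤ 1 * ‖gam n z‖ * Real.exp ‖z‖ := by gcongr
    _ = _ := by ring

def gami (n : ℕ) (i : Fin n) (z : E n) : ℝ := -(1/2) * z i * gam n z

lemma gamD_apply (i : Fin n) (z : E n) : gamD n z (ee i) = gami n i z := by
  simp [gamD, gami, EuclideanSpace.inner_single_right]; ring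

lemma gami_cont (i : Fin n) : Continuous (gami n i) := by
  unfold gami
  have := gam_cont n
  fun_prop

lemma AD_gami (i : Fin n) : AD (gami n i) := by
  have := (AD_gamD (n := n)).apply (ee i)
  simpa only [gamD_apply] using this

def gamiD (n : ℕ) (i : Fin n) (z : E n) : E n →L[ℝ] ℝ :=
  (-(1/2) * gam n z) • (EuclideanSpace.proj i : E n →L[ℝ] ℝ) + (-(1/2) * z i) • gamD n z

lemma hasFDerivAt_gami (i : Fin n) (z : E n) : HasFDerivAt (gami n i) (gamiD n i z) z := by
  have h1 : HasFDerivAt (fun z : E n => z i) (EuclideanSpace.proj i : E n →L[ℝ] ℝ) z :=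
    (EuclideanSpace.proj i : E n →L[ℝ] ℝ).hasFDerivAt
  have h2 := (h1.const_mul (-(1/2) : ℝ)).mul (hasFDerivAt_gam z)
  refine HasFDerivAt.congr_fderiv (f := gami n i) h2 ?_
  ext v; simp [gamiD]; ring

lemma gamiD_cont (i : Fin n) : Continuous (gamiD n i) := by
  unfold gamiD
  have := gam_cont n
  have := gamD_cont (n := n)
  fun_prop

lemma AD_gamiD (i : Fin n) : AD (gamiD n i) := by
  unfold gamiD
  refine AD.add ((AD_gam n).mono (1/2 * ‖(EuclideanSpace.proj i : E n →L[ℝ] ℝ)‖) 0 (by positivity) fun z => ?_)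
    ((AD_gamD (n := n)).mono 1 1 zero_le_one fun z => ?_)
  · rw [norm_smul, norm_mul]; norm_num; apply le_of_eq; ring
  · rw [norm_smul, norm_mul, one_mul, one_mul]
    gcongr
    have h1 := (abs_coord_le z i).trans (norm_le_exp_norm z)
    have h0 : ‖(-(1/2) : ℝ)‖ ≤ 1 := by norm_num
    calc _ ≤ 1 * Real.exp ‖z‖ := by gcongr; exact h1
      _ = _ := one_mul _

/-- heat kernel in scaled form -/
lemma heat_eq_Iav {τ : ℝ} (hτ : 0 < τ) (h : E n → ℝ) (x : E n) :
    ∫ y, heatKernel n τ (x - y) * h y = Iav (gam n) h x √τ := by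
  have hs : 0 < √τ := Real.sqrt_pos.2 hτ
  have e1 : ∫ y, heatKernel n τ (x - y) * h y = ∫ y, heatKernel n τ y * h (x + y) := by
    rw [← integral_add_left_eq_self _ x]
    refine integral_congr_ae (ae_of_all _ fun y => ?_)
    simp [heatKernel]
  have e2 := Measure.integral_comp_smul (volume : Measure (E n)) (fun y => heatKernel n τ y * h (x + y)) √τ
  rw [finrank_euclideanSpace_fin, abs_of_pos (by positivity), smul_eq_mul] at e2
  have e3 : Iav (gam n) h x √τ = √τ ^ n * ∫ z : E n, heatKernel n τ (√τ • z) * h (x + √τ • z) := by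
    rw [Iav, ← integral_const_mul]
    refine integral_congr_ae (ae_of_all _ fun z => ?_)
    simp only [heatKernel, gam, norm_smul, smul_eq_mul]
    rw [Real.norm_eq_abs, abs_of_pos hs, mul_pow, Real.sq_sqrt hτ.le, mul_rpow (by positivity) hτ.le]
    have : τ ^ (-(n:ℝ)/2) = (√τ ^ n)⁻¹ := by
      rw [Real.sqrt_eq_rpow, ← Real.rpow_natCast, ← Real.rpow_mul hτ.le, ← Real.rpow_neg hτ.le]
      congr 1; ring
    rw [this, show -(τ * ‖z‖^2) / (4 * τ) = -‖z‖^2/4 by field_simp]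
    field_simp
  rw [e3, e2, e1, ← mul_assoc, mul_inv_cancel₀ (by positivity), one_mul]

end

end

section
section
variable {n : ℕ} {F : Type*} [NormedAddCommGroup F] [NormedSpace ℝ F]

structure HC (T C κ : ℝ) (h : E n → ℝ → ℝ) : Prop where
  cont : ContinuousOn (fun p : E n × ℝ => h p.1 p.2) (univ ×ˢ Ioo 0 T)
  bd : ∀ y, ∀ s ∈ Ioo 0 T, |h y s| ≤ C * (√s)⁻¹ * Real.exp (κ * ‖y‖)

lemma HC.EB {T C κ : ℝ} {h : E n → ℝ → ℝ} (H : HC T C κ h) {s : ℝ} (hs : s ∈ Ioo 0 T) :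
    EB (C * (√s)⁻¹) κ (fun y => h y s) := fun y => H.bd y s hs

lemma HC.slice {T C κ : ℝ} {h : E n → ℝ → ℝ} (H : HC T C κ h) {s : ℝ} (hs : s ∈ Ioo 0 T) :
    Continuous (fun y => h y s) := by
  rw [← continuousOn_univ]
  exact H.cont.comp (f := fun y => (y, s)) (by fun_prop) (fun y _ => ⟨mem_univ _, hs⟩)

lemma HC.nonneg {T C κ : ℝ} {h : E n → ℝ → ℝ} (H : HC T C κ h) (hT : 0 < T) : 0 ≤ C := by
  have h1 := (H.EB (s := T/2) ⟨by linarith, by linarith⟩).C_nonneg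
  have : 0 < (√(T/2))⁻¹ := by positivity
  exact nonneg_of_mul_nonneg_left h1 this

lemma Iav_continuousOn {T C κ : ℝ} (hκ : 0 ≤ κ) {h : E n → ℝ → ℝ} (H : HC T C κ h)
    {η : E n → F} (had : AD η) (hη : Continuous η) :
    ContinuousOn (fun p : E n × ℝ × ℝ => Iav η (fun y => h y p.2.2) p.1 p.2.1)
      (univ ×ˢ univ ×ˢ Ioo 0 T) := by
  have hopen : IsOpen ((univ : Set (E n)) ×ˢ (univ : Set ℝ) ×ˢ Ioo (0:ℝ) T) :=
    isOpen_univ.prod (isOpen_univ.prod isOpen_Ioo)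
  have hopen2 : IsOpen ((univ : Set (E n)) ×ˢ Ioo (0:ℝ) T) := isOpen_univ.prod isOpen_Ioo
  rw [hopen.continuousOn_iff]
  rintro ⟨x₀, r₀, s₀⟩ ⟨-, -, hs₀⟩
  have hs₀' : s₀ ∈ Ioo 0 T := hs₀
  have hC := H.nonneg (hs₀'.1.trans hs₀'.2)
  have hnb : ∀ᶠ p : E n × ℝ × ℝ in 𝓝 (x₀, r₀, s₀), ‖p.1‖ < ‖x₀‖ + 1 ∧ |p.2.1| < |r₀| + 1 ∧
      p.2.2 ∈ Ioo (s₀/2) T := by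
    have a1 : ContinuousAt (fun p : E n × ℝ × ℝ => ‖p.1‖) (x₀, r₀, s₀) := by fun_prop
    have a2 : ContinuousAt (fun p : E n × ℝ × ℝ => |p.2.1|) (x₀, r₀, s₀) := by fun_prop
    have a3 : ContinuousAt (fun p : E n × ℝ × ℝ => p.2.2) (x₀, r₀, s₀) := by fun_prop
    filter_upwards [a1.eventually (gt_mem_nhds (lt_add_one ‖x₀‖)),
      a2.eventually (gt_mem_nhds (lt_add_one |r₀|)),
      a3.eventually (Ioo_mem_nhds (a := s₀/2) (b := T) (by linarith [hs₀'.1]) hs₀'.2)] with p h1 h2 h3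
    exact ⟨h1, h2, h3⟩
  unfold Iav
  refine continuousAt_of_dominated (bound := fun z => (C * (√(s₀/2))⁻¹ * Real.exp (κ * (‖x₀‖ + 1))) *
    (Real.exp (κ * (|r₀| + 1) * ‖z‖) * ‖η z‖)) ?_ ?_ ((had.integrable_exp hη _).const_mul _) ?_
  · filter_upwards [hnb] with p hp
    have hs : p.2.2 ∈ Ioo 0 T := ⟨by linarith [hp.2.2.1, hs₀'.1], hp.2.2.2⟩
    have := H.slice hs
    exact (Continuous.smul (this.comp (g := fun y => h y p.2.2) (f := fun z => p.1 + p.2.1 • z) (by fun_prop)) hη).aestronglyMeasurable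
  · filter_upwards [hnb] with p hp
    have hs : p.2.2 ∈ Ioo 0 T := ⟨by linarith [hp.2.2.1, hs₀'.1], hp.2.2.2⟩
    refine ae_of_all _ fun z => ?_
    have h2 := (H.EB hs).shift hκ hp.2.1.le p.1 z
    rw [norm_smul, ← mul_assoc, Real.norm_eq_abs]
    gcongr
    refine h2.trans ?_
    have : 0 < s₀/2 := by linarith [hs₀'.1]
    gcongr
    · exact hp.2.2.1.le
    · exact hp.1.le
  · refine ae_of_all _ fun z => ?_
    have h1 : ContinuousAt (fun p : E n × ℝ => h p.1 p.2) (x₀ + r₀ • z, s₀) :=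
      hopen2.continuousOn_iff.1 H.cont ⟨mem_univ _, hs₀⟩
    have h2 : ContinuousAt (fun p : E n × ℝ × ℝ => h (p.1 + p.2.1 • z) p.2.2) (x₀, r₀, s₀) :=
      ContinuousAt.comp (g := fun p : E n × ℝ => h p.1 p.2) (f := fun p : E n × ℝ × ℝ => (p.1 + p.2.1 • z, p.2.2)) h1 (by fun_prop)
    exact h2.smul continuousAt_const

/-! ### time integrals -/

lemma setIntegral_scale {t : ℝ} (ht : 0 < t) (f : ℝ → F) :
    ∫ s in Ioo 0 t, f s = t • ∫ σ in Ioo (0:ℝ) 1, f (t * σ) := by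
  rw [← integral_Ioc_eq_integral_Ioo, ← integral_Ioc_eq_integral_Ioo,
    ← intervalIntegral.integral_of_le ht.le, ← intervalIntegral.integral_of_le zero_le_one,
    intervalIntegral.integral_comp_mul_left _ ht.ne', smul_smul, mul_inv_cancel₀ ht.ne', one_smul]
  simp

lemma inv_sqrt_integrableOn {t : ℝ} (ht : 0 < t) : IntegrableOn (fun s => (√s)⁻¹) (Ioo 0 t) := by
  have h := intervalIntegral.intervalIntegrable_rpow' (a := 0) (b := t) (r := -(1/2)) (by norm_num)
  rw [intervalIntegrable_iff_integrableOn_Ioo_of_le ht.le] at h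
  refine h.congr_fun (fun s hs => ?_) measurableSet_Ioo
  simp only
  rw [Real.rpow_neg hs.1.le, Real.sqrt_eq_rpow]

lemma inv_sqrt_integrableOn' {t : ℝ} (ht : 0 < t) : IntegrableOn (fun s => (√(t - s))⁻¹) (Ioo 0 t) := by
  have h := inv_sqrt_integrableOn ht
  rw [← intervalIntegrable_iff_integrableOn_Ioo_of_le ht.le] at h ⊢
  have := h.comp_sub_left t
  simpa using this.symm

lemma beta_integrableOn {t : ℝ} (ht : 0 < t) :
    IntegrableOn (fun s => (√(t - s))⁻¹ * (√s)⁻¹) (Ioo 0 t) := by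
  refine (((inv_sqrt_integrableOn ht).add (inv_sqrt_integrableOn' ht)).const_mul (√t)⁻¹).mono'
    (Measurable.aestronglyMeasurable (by fun_prop)) ?_
  refine (ae_restrict_iff' measurableSet_Ioo).2 (ae_of_all _ fun s hs => ?_)
  have h1 : 0 < √s := Real.sqrt_pos.2 hs.1
  have h2 : 0 < √(t - s) := Real.sqrt_pos.2 (by linarith [hs.2])
  have h3 : 0 < √t := Real.sqrt_pos.2 ht
  rw [Real.norm_eq_abs, abs_of_pos (by positivity)]
  have h4 : √t ≤ √(t-s) + √s := by
    rw [Real.sqrt_le_left (by positivity)]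
    have a1 := Real.sq_sqrt hs.1.le
    have a2 := Real.sq_sqrt (show 0 ≤ t - s by linarith [hs.2])
    nlinarith [mul_pos h1 h2]
  simp only [Pi.add_apply]
  rw [show (√t)⁻¹ * ((√s)⁻¹ + (√(t-s))⁻¹) = (√(t-s))⁻¹ * (√s)⁻¹ * ((√(t-s) + √s) / √t) by field_simp]
  refine le_mul_of_one_le_right (by positivity) ?_
  rwa [one_le_div h3]

def betaB : ℝ := ∫ σ in Ioo (0:ℝ) 1, (√(1 - σ))⁻¹ * (√σ)⁻¹

lemma betaB_nonneg : 0 ≤ betaB := integral_nonneg fun s => by positivity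

lemma beta_integral {t : ℝ} (ht : 0 < t) : ∫ s in Ioo 0 t, (√(t - s))⁻¹ * (√s)⁻¹ = betaB := by
  rw [setIntegral_scale ht, betaB, smul_eq_mul, ← integral_const_mul]
  refine integral_congr_ae (ae_of_all _ fun s => ?_)
  simp only
  rw [show t - t * s = t * (1 - s) by ring, Real.sqrt_mul ht.le, Real.sqrt_mul ht.le]
  have h3 : 0 < √t := Real.sqrt_pos.2 ht
  have h4 : √t * √t = t := Real.mul_self_sqrt ht.le
  rw [mul_inv, mul_inv]
  calc _ = t * ((√t * √t)⁻¹) * ((√(1-s))⁻¹ * (√s)⁻¹) := by rw [mul_inv]; ring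
    _ = _ := by rw [h4, mul_inv_cancel₀ ht.ne', one_mul]

structure KC (T C κ : ℝ) (K : E n → ℝ → ℝ → F) : Prop where
  cont : ContinuousOn (fun p : E n × ℝ × ℝ => K p.1 p.2.1 p.2.2) (univ ×ˢ Ioo 0 T ×ˢ Ioo 0 T)
  bd : ∀ x, ∀ τ ∈ Ioo 0 T, ∀ s ∈ Ioo 0 T, ‖K x τ s‖ ≤ C * Real.exp (κ * ‖x‖) * ((√τ)⁻¹ * (√s)⁻¹)

def Jt (K : E n → ℝ → ℝ → F) (x : E n) (t : ℝ) : F := ∫ s in Ioo 0 t, K x (t - s) s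

lemma KC.nonneg {T C κ : ℝ} {K : E n → ℝ → ℝ → F} (H : KC T C κ K) (hT : 0 < T) : 0 ≤ C := by
  have h2 : T/2 ∈ Ioo 0 T := ⟨by linarith, by linarith⟩
  have h1 := (norm_nonneg _).trans (H.bd 0 (T/2) h2 (T/2) h2)
  have h3 : 0 < (√(T/2))⁻¹ := by positivity
  simp only [norm_zero, mul_zero, Real.exp_zero, mul_one] at h1
  exact nonneg_of_mul_nonneg_left h1 (by positivity)

lemma KC.meas {T C κ : ℝ} {K : E n → ℝ → ℝ → F} (H : KC T C κ K) (x : E n) {t : ℝ} (ht : t ∈ Ioo 0 T) :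
    AEStronglyMeasurable (fun s => K x (t - s) s) (volume.restrict (Ioo 0 t)) := by
  refine ContinuousOn.aestronglyMeasurable ?_ measurableSet_Ioo
  exact H.cont.comp (f := fun s : ℝ => (x, t - s, s)) (by fun_prop)
    (fun s hs => ⟨mem_univ _, ⟨by simp [hs.2], by simp; linarith [hs.1, ht.2]⟩, ⟨hs.1, hs.2.trans ht.2⟩⟩)

lemma KC.integrableOn {T C κ : ℝ} {K : E n → ℝ → ℝ → F} (H : KC T C κ K) (x : E n) {t : ℝ} (ht : t ∈ Ioo 0 T) :
    IntegrableOn (fun s => K x (t - s) s) (Ioo 0 t) := by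
  refine ((beta_integrableOn ht.1).const_mul (C * Real.exp (κ * ‖x‖))).mono' (H.meas x ht) ?_
  refine (ae_restrict_iff' measurableSet_Ioo).2 (ae_of_all _ fun s hs => ?_)
  exact H.bd x _ ⟨by linarith [hs.2], by linarith [hs.1, ht.2]⟩ _ ⟨hs.1, hs.2.trans ht.2⟩

lemma KC.norm_Jt_le {T C κ : ℝ} {K : E n → ℝ → ℝ → F} (H : KC T C κ K) (x : E n) {t : ℝ} (ht : t ∈ Ioo 0 T) :
    ‖Jt K x t‖ ≤ C * betaB * Real.exp (κ * ‖x‖) := by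
  have : C * betaB * Real.exp (κ * ‖x‖) = ∫ s in Ioo 0 t, C * Real.exp (κ * ‖x‖) * ((√(t - s))⁻¹ * (√s)⁻¹) := by
    rw [integral_const_mul, beta_integral ht.1]; ring
  rw [this]
  refine norm_integral_le_of_norm_le ((beta_integrableOn ht.1).const_mul _) ?_
  refine (ae_restrict_iff' measurableSet_Ioo).2 (ae_of_all _ fun s hs => ?_)
  exact H.bd x _ ⟨by linarith [hs.2], by linarith [hs.1, ht.2]⟩ _ ⟨hs.1, hs.2.trans ht.2⟩

lemma KC.continuousOn_Jt {T C κ : ℝ} (hκ : 0 ≤ κ) {K : E n → ℝ → ℝ → F} (H : KC T C κ K) :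
    ContinuousOn (fun p : E n × ℝ => Jt K p.1 p.2) (univ ×ˢ Ioo 0 T) := by
  have hopen2 : IsOpen ((univ : Set (E n)) ×ˢ Ioo (0:ℝ) T) := isOpen_univ.prod isOpen_Ioo
  have hopen : IsOpen ((univ : Set (E n)) ×ˢ Ioo (0:ℝ) T ×ˢ Ioo (0:ℝ) T) :=
    isOpen_univ.prod (isOpen_Ioo.prod isOpen_Ioo)
  have e : ∀ p ∈ ((univ : Set (E n)) ×ˢ Ioo (0:ℝ) T), Jt K p.1 p.2 =
      p.2 • ∫ σ in Ioo (0:ℝ) 1, K p.1 (p.2 * (1 - σ)) (p.2 * σ) := by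
    rintro p ⟨-, hp⟩
    have hp' : p.2 ∈ Ioo 0 T := hp
    rw [Jt, setIntegral_scale hp'.1]
    simp only [mul_sub, mul_one]
  refine ContinuousOn.congr ?_ e
  refine ContinuousOn.smul (by fun_prop) ?_
  rw [hopen2.continuousOn_iff]
  rintro ⟨x₀, t₀⟩ ⟨-, ht₀⟩
  have ht₀' : t₀ ∈ Ioo 0 T := ht₀
  have hC := H.nonneg (ht₀'.1.trans ht₀'.2)
  have hnb : ∀ᶠ p : E n × ℝ in 𝓝 (x₀, t₀), ‖p.1‖ < ‖x₀‖ + 1 ∧ p.2 ∈ Ioo (t₀/2) T := by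
    have a1 : ContinuousAt (fun p : E n × ℝ => ‖p.1‖) (x₀, t₀) := by fun_prop
    have a3 : ContinuousAt (fun p : E n × ℝ => p.2) (x₀, t₀) := by fun_prop
    filter_upwards [a1.eventually (gt_mem_nhds (lt_add_one ‖x₀‖)),
      a3.eventually (Ioo_mem_nhds (a := t₀/2) (b := T) (by linarith [ht₀'.1]) ht₀'.2)] with p h1 h3
    exact ⟨h1, h3⟩
  have hmem : ∀ t ∈ Ioo 0 T, ∀ σ ∈ Ioo (0:ℝ) 1, t * (1 - σ) ∈ Ioo 0 T ∧ t * σ ∈ Ioo 0 T := by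
    intro t ht σ hσ
    have h0 := ht.1
    have h1 := ht.2
    have h2 := hσ.1
    have h3 := hσ.2
    refine ⟨⟨mul_pos h0 (by linarith), by nlinarith⟩, ⟨by positivity, by nlinarith⟩⟩
  refine continuousAt_of_dominated (bound := fun σ => (C * Real.exp (κ * (‖x₀‖ + 1)) * (t₀/2)⁻¹) *
    ((√(1 - σ))⁻¹ * (√σ)⁻¹)) ?_ ?_ ((beta_integrableOn one_pos).const_mul _) ?_
  · filter_upwards [hnb] with p hp
    have hs : p.2 ∈ Ioo 0 T := ⟨by linarith [hp.2.1, ht₀'.1], hp.2.2⟩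
    refine ContinuousOn.aestronglyMeasurable ?_ measurableSet_Ioo
    exact H.cont.comp (f := fun s : ℝ => (p.1, p.2 * (1 - s), p.2 * s)) (by fun_prop)
      (fun s hs' => ⟨mem_univ _, hmem _ hs _ hs'⟩)
  · filter_upwards [hnb] with p hp
    have hs : p.2 ∈ Ioo 0 T := ⟨by linarith [hp.2.1, ht₀'.1], hp.2.2⟩
    refine (ae_restrict_iff' measurableSet_Ioo).2 (ae_of_all _ fun s hs' => ?_)
    refine (H.bd p.1 _ (hmem _ hs _ hs').1 _ (hmem _ hs _ hs').2).trans ?_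
    rw [Real.sqrt_mul hs.1.le, Real.sqrt_mul hs.1.le]
    have h4 : √p.2 * √p.2 = p.2 := Real.mul_self_sqrt hs.1.le
    rw [show (√p.2 * √(1-s))⁻¹ * (√p.2 * √s)⁻¹ = p.2⁻¹ * ((√(1-s))⁻¹ * (√s)⁻¹) by
      rw [← h4]; simp only [mul_inv]; rw [h4]; ring, ← mul_assoc]
    have := ht₀'.1
    have hp0 := hs.1
    gcongr
    · exact hp.1.le
    · exact hp.2.1.le
  · refine (ae_restrict_iff' measurableSet_Ioo).2 (ae_of_all _ fun s hs' => ?_)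
    have h1 : ContinuousAt (fun p : E n × ℝ × ℝ => K p.1 p.2.1 p.2.2) (x₀, t₀ * (1 - s), t₀ * s) :=
      hopen.continuousOn_iff.1 H.cont ⟨mem_univ _, hmem _ ht₀' _ hs'⟩
    exact ContinuousAt.comp (g := fun p : E n × ℝ × ℝ => K p.1 p.2.1 p.2.2)
      (f := fun p : E n × ℝ => (p.1, p.2 * (1 - s), p.2 * s)) h1 (by fun_prop)

lemma KC.hasFDerivAt_Jt {T C C' κ : ℝ} (hκ : 0 ≤ κ) {K : E n → ℝ → ℝ → F}
    {K' : E n → ℝ → ℝ → (E n →L[ℝ] F)} (H : KC T C κ K) (H' : KC T C' κ K')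
    (hd : ∀ x, ∀ τ ∈ Ioo 0 T, ∀ s ∈ Ioo 0 T, HasFDerivAt (fun x => K x τ s) (K' x τ s) x)
    (x₀ : E n) {t : ℝ} (ht : t ∈ Ioo 0 T) :
    HasFDerivAt (fun x => Jt K x t) (Jt K' x₀ t) x₀ := by
  have hC := H'.nonneg (ht.1.trans ht.2)
  unfold Jt
  refine hasFDerivAt_integral_of_dominated_of_fderiv_le (s := ball x₀ 1)
    (F := fun x s => K x (t - s) s) (F' := fun x s => K' x (t - s) s)
    (bound := fun s => (C' * Real.exp (κ * (‖x₀‖ + 1))) * ((√(t - s))⁻¹ * (√s)⁻¹))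
    (ball_mem_nhds _ one_pos) (Eventually.of_forall fun x => H.meas x ht) (H.integrableOn x₀ ht)
    (H'.meas x₀ ht) ?_ ((beta_integrableOn ht.1).const_mul _) ?_
  · refine (ae_restrict_iff' measurableSet_Ioo).2 (ae_of_all _ fun s hs x hx => ?_)
    refine (H'.bd x _ ⟨by linarith [hs.2], by linarith [hs.1, ht.2]⟩ _ ⟨hs.1, hs.2.trans ht.2⟩).trans ?_
    gcongr
    rw [mem_ball_iff_norm] at hx
    have := norm_sub_norm_le x x₀
    linarith
  · refine (ae_restrict_iff' measurableSet_Ioo).2 (ae_of_all _ fun s hs x hx => ?_)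
    exact hd x _ ⟨by linarith [hs.2], by linarith [hs.1, ht.2]⟩ _ ⟨hs.1, hs.2.trans ht.2⟩

end

end

section
lemma triangle_swap {T C t : ℝ} {q : ℝ → ℝ → ℝ} (ht : t ∈ Ioo 0 T)
    (hq : ContinuousOn (fun p : ℝ × ℝ => q p.1 p.2) (Ioo 0 T ×ˢ Ioo 0 T))
    (hb : ∀ τ ∈ Ioo 0 T, ∀ s ∈ Ioo 0 T, |q τ s| ≤ C * ((√τ)⁻¹ * (√s)⁻¹)) :
    IntegrableOn (fun s => ∫ τ in Ioo 0 (t - s), q τ s) (Ioo 0 t) ∧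
    ∫ s in Ioo 0 t, ∫ τ in Ioo 0 (t - s), q τ s = ∫ ρ in Ioo 0 t, ∫ s in Ioo 0 ρ, q (ρ - s) s := by
  set μ : Measure ℝ := volume.restrict (Ioo 0 t) with hμ
  set S : Set (ℝ × ℝ) := {p | 0 < p.1 ∧ p.1 < p.2 ∧ p.2 < t} with hS
  have hSo : IsOpen S := (isOpen_lt continuous_const continuous_fst).inter
    ((isOpen_lt continuous_fst continuous_snd).inter (isOpen_lt continuous_snd continuous_const))
  have hSm := hSo.measurableSet
  set Φ : ℝ × ℝ → ℝ := S.indicator (fun p => q (p.2 - p.1) p.1) with hΦ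
  set β : ℝ × ℝ → ℝ := S.indicator (fun p => (√(p.2 - p.1))⁻¹ * (√p.1)⁻¹) with hβ
  have hβm : Measurable β := Measurable.indicator (by fun_prop) hSm
  have hβint : Integrable β (μ.prod μ) := by
    rw [integrable_prod_iff' hβm.aestronglyMeasurable]
    have key : ∀ ρ ∈ Ioo 0 t, (fun s => β (s, ρ)) = (Ioo 0 ρ).indicator (fun s => (√(ρ - s))⁻¹ * (√s)⁻¹) := by
      intro ρ hρ
      ext s
      simp only [hβ, indicator, hS, mem_ofPred_eq, mem_Ioo, hρ.2, and_true]
    have key2 : ∀ ρ ∈ Ioo 0 t, Integrable (fun s => β (s, ρ)) μ ∧ ∫ s, ‖β (s, ρ)‖ ∂μ = betaB := by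
      intro ρ hρ
      have e0 : (volume.restrict (Ioo 0 t)).restrict (Ioo 0 ρ) = volume.restrict (Ioo 0 ρ) := by
        rw [Measure.restrict_restrict measurableSet_Ioo, inter_eq_self_of_subset_left (Ioo_subset_Ioo_right hρ.2.le)]
      constructor
      · rw [key ρ hρ, integrable_indicator_iff measurableSet_Ioo, IntegrableOn, hμ, e0]
        exact beta_integrableOn hρ.1
      · have : (fun s => ‖β (s, ρ)‖) = fun s => β (s, ρ) := by
          ext s
          rw [Real.norm_eq_abs, abs_of_nonneg]
          exact indicator_nonneg (fun p _ => by positivity) _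
        rw [this, key ρ hρ, integral_indicator measurableSet_Ioo, hμ, e0]
        exact beta_integral hρ.1
    constructor
    · exact (ae_restrict_iff' measurableSet_Ioo).2 (ae_of_all _ fun ρ hρ => (key2 ρ hρ).1)
    · refine (integrable_const betaB).congr ?_
      exact (ae_restrict_iff' measurableSet_Ioo).2 (ae_of_all _ fun ρ hρ => (key2 ρ hρ).2.symm)
  have hmem : ∀ p ∈ S, p.2 - p.1 ∈ Ioo 0 T ∧ p.1 ∈ Ioo 0 T := by
    rintro p ⟨h1, h2, h3⟩
    exact ⟨⟨by linarith, by linarith [ht.2]⟩, ⟨h1, by linarith [ht.2]⟩⟩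
  have hΦint : Integrable Φ (μ.prod μ) := by
    refine (hβint.const_mul C).mono' ?_ (ae_of_all _ fun p => ?_)
    · rw [hΦ, aestronglyMeasurable_indicator_iff hSm]
      refine ContinuousOn.aestronglyMeasurable ?_ hSm
      exact hq.comp (f := fun p : ℝ × ℝ => (p.2 - p.1, p.1)) (by fun_prop) hmem
    · by_cases hp : p ∈ S
      · simp only [hΦ, hβ, indicator_of_mem hp]
        exact hb _ (hmem p hp).1 _ (hmem p hp).2
      · simp [hΦ, hβ, indicator_of_notMem hp]
  have e1 : ∀ s ∈ Ioo 0 t, ∫ ρ, Φ (s, ρ) ∂μ = ∫ τ in Ioo 0 (t - s), q τ s := by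
    intro s hs
    have e0 : (volume.restrict (Ioo 0 t)).restrict (Ioo s t) = volume.restrict (Ioo s t) := by
        rw [Measure.restrict_restrict measurableSet_Ioo, inter_eq_self_of_subset_left (Ioo_subset_Ioo_left hs.1.le)]
    have : (fun ρ => Φ (s, ρ)) = (Ioo s t).indicator (fun ρ => q (ρ - s) s) := by
      ext ρ
      simp only [hΦ, indicator, hS, mem_ofPred_eq, mem_Ioo, hs.1, true_and]
    rw [this, integral_indicator measurableSet_Ioo, hμ, e0, ← integral_Ioc_eq_integral_Ioo,
      ← integral_Ioc_eq_integral_Ioo, ← intervalIntegral.integral_of_le hs.2.le,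
      ← intervalIntegral.integral_of_le (by linarith [hs.2]),
      intervalIntegral.integral_comp_sub_right (fun τ => q τ s) s, sub_self]
  have e2 : ∀ ρ ∈ Ioo 0 t, ∫ s, Φ (s, ρ) ∂μ = ∫ s in Ioo 0 ρ, q (ρ - s) s := by
    intro ρ hρ
    have e0 : (volume.restrict (Ioo 0 t)).restrict (Ioo 0 ρ) = volume.restrict (Ioo 0 ρ) := by
        rw [Measure.restrict_restrict measurableSet_Ioo, inter_eq_self_of_subset_left (Ioo_subset_Ioo_right hρ.2.le)]
    have : (fun s => Φ (s, ρ)) = (Ioo 0 ρ).indicator (fun s => q (ρ - s) s) := by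
      ext s
      simp only [hΦ, indicator, hS, mem_ofPred_eq, mem_Ioo, hρ.2, and_true]
    rw [this, integral_indicator measurableSet_Ioo, hμ, e0]
  constructor
  · refine Integrable.congr hΦint.integral_prod_left ?_
    exact (ae_restrict_iff' measurableSet_Ioo).2 (ae_of_all _ e1)
  · rw [← setIntegral_congr_fun measurableSet_Ioo e1, ← setIntegral_congr_fun measurableSet_Ioo e2]
    exact integral_integral_swap hΦint

section
variable {n : ℕ} {F : Type*} [NormedAddCommGroup F] [NormedSpace ℝ F]

lemma HC.toKC {T C κ c : ℝ} (hκ : 0 ≤ κ) {h : E n → ℝ → ℝ} (H : HC T C κ h)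
    {η : E n → F} (had : AD η) (hη : Continuous η) {ρ : ℝ → ℝ} (hρ : ContinuousOn ρ (Ioo 0 T))
    (hρb : ∀ τ ∈ Ioo 0 T, |ρ τ| ≤ c * (√τ)⁻¹) :
    KC T (c * C * ∫ z, Real.exp (κ * √T * ‖z‖) * ‖η z‖) κ
      (fun x τ s => ρ τ • Iav η (fun y => h y s) x √τ) where
  cont := by
    refine ContinuousOn.smul (hρ.comp (f := fun p : E n × ℝ × ℝ => p.2.1) (by fun_prop) (fun p hp => hp.2.1)) ?_
    exact (Iav_continuousOn hκ H had hη).comp (f := fun p : E n × ℝ × ℝ => (p.1, √p.2.1, p.2.2)) (by fun_prop)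
      (fun p hp => ⟨mem_univ _, mem_univ _, hp.2.2⟩)
  bd := by
    intro x τ hτ s hs
    have h1 := norm_Iav_le had hη hκ (H.EB hs) x (r := √τ) (R := √T)
      (by rw [abs_of_nonneg (Real.sqrt_nonneg _)]; exact Real.sqrt_le_sqrt hτ.2.le)
    rw [norm_smul, Real.norm_eq_abs]
    have h2 := (abs_nonneg _).trans (hρb τ hτ)
    calc _ ≤ (c * (√τ)⁻¹) * (C * (√s)⁻¹ * rexp (κ * ‖x‖) * ∫ z, rexp (κ * √T * ‖z‖) * ‖η z‖) := by
          gcongr; exact hρb τ hτ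
      _ = _ := by ring

lemma KC.sum {T κ : ℝ} {K : Fin n → E n → ℝ → ℝ → F} {C : Fin n → ℝ} (H : ∀ i, KC T (C i) κ (K i)) :
    KC T (∑ i, C i) κ (fun x τ s => ∑ i, K i x τ s) where
  cont := continuousOn_finsetSum _ fun i _ => (H i).cont
  bd := by
    intro x τ hτ s hs
    refine (norm_sum_le _ _).trans ?_
    rw [Finset.sum_mul, Finset.sum_mul]
    exact Finset.sum_le_sum fun i _ => (H i).bd x τ hτ s hs

def Wop (h : E n → ℝ → ℝ) : E n → ℝ → ℝ := Jt (fun x τ s => Iav (gam n) (fun y => h y s) x √τ)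
def WD (h : E n → ℝ → ℝ) : E n → ℝ → (E n →L[ℝ] ℝ) :=
  Jt (fun x τ s => (-(√τ)⁻¹) • Iav (gamD n) (fun y => h y s) x √τ)
def Wi (i : Fin n) (h : E n → ℝ → ℝ) : E n → ℝ → ℝ :=
  Jt (fun x τ s => (-(√τ)⁻¹) • Iav (gami n i) (fun y => h y s) x √τ)

lemma rho_cont (T : ℝ) : ContinuousOn (fun τ : ℝ => -(√τ)⁻¹) (Ioo 0 T) := by
  refine ContinuousOn.neg (ContinuousOn.inv₀ (by fun_prop) fun τ hτ => ?_)
  exact (Real.sqrt_pos.2 hτ.1).ne'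

lemma rho_bd (T : ℝ) : ∀ τ ∈ Ioo 0 T, |(-(√τ)⁻¹)| ≤ 1 * (√τ)⁻¹ := by
  intro τ hτ
  rw [abs_neg, abs_of_nonneg (by positivity), one_mul]

variable {T C κ : ℝ} {h : E n → ℝ → ℝ}

lemma HC.KC_W (hκ : 0 ≤ κ) (H : HC T C κ h) : ∃ C', KC T C' κ (fun x τ s => Iav (gam n) (fun y => h y s) x √τ) := by
  have := H.toKC hκ (AD_gam n) (gam_cont n) (ρ := fun _ => 1) (c := √T) continuousOn_const (fun τ hτ => by
    have h1 : 0 < √τ := Real.sqrt_pos.2 hτ.1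
    rw [abs_one, ← div_eq_mul_inv, one_le_div h1]
    exact Real.sqrt_le_sqrt hτ.2.le)
  simp only [one_smul] at this
  exact ⟨_, this⟩

lemma HC.KC_WD (hκ : 0 ≤ κ) (H : HC T C κ h) :
    ∃ C', KC T C' κ (fun x τ s => (-(√τ)⁻¹) • Iav (gamD n) (fun y => h y s) x √τ) :=
  ⟨_, H.toKC hκ AD_gamD gamD_cont (rho_cont T) (rho_bd T)⟩

lemma HC.KC_Wi (hκ : 0 ≤ κ) (H : HC T C κ h) (i : Fin n) :
    ∃ C', KC T C' κ (fun x τ s => (-(√τ)⁻¹) • Iav (gami n i) (fun y => h y s) x √τ) :=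
  ⟨_, H.toKC hκ (AD_gami i) (gami_cont i) (rho_cont T) (rho_bd T)⟩

lemma W_cont (hκ : 0 ≤ κ) (H : HC T C κ h) :
    ContinuousOn (fun p : E n × ℝ => Wop h p.1 p.2) (univ ×ˢ Ioo 0 T) := by
  obtain ⟨C', hk⟩ := H.KC_W hκ
  exact hk.continuousOn_Jt hκ

lemma WD_cont (hκ : 0 ≤ κ) (H : HC T C κ h) :
    ContinuousOn (fun p : E n × ℝ => WD h p.1 p.2) (univ ×ˢ Ioo 0 T) := by
  obtain ⟨C', hk⟩ := H.KC_WD hκ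
  exact hk.continuousOn_Jt hκ

lemma Wi_cont (hκ : 0 ≤ κ) (H : HC T C κ h) (i : Fin n) :
    ContinuousOn (fun p : E n × ℝ => Wi i h p.1 p.2) (univ ×ˢ Ioo 0 T) := by
  obtain ⟨C', hk⟩ := H.KC_Wi hκ i
  exact hk.continuousOn_Jt hκ

lemma WD_bound (hκ : 0 ≤ κ) (hT : 0 < T) (H : HC T C κ h) : ∃ C', 0 ≤ C' ∧ ∀ x, ∀ t ∈ Ioo 0 T,
    ‖WD h x t‖ ≤ C' * Real.exp (κ * ‖x‖) := by
  obtain ⟨C', hk⟩ := H.KC_WD hκ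
  exact ⟨C' * betaB, mul_nonneg (hk.nonneg hT) betaB_nonneg, fun x t ht => hk.norm_Jt_le x ht⟩

lemma W_hasFDerivAt (hκ : 0 ≤ κ) (H : HC T C κ h) (x : E n) {t : ℝ} (ht : t ∈ Ioo 0 T) :
    HasFDerivAt (fun x => Wop h x t) (WD h x t) x := by
  obtain ⟨C₁, hk⟩ := H.KC_W hκ
  obtain ⟨C₂, hk'⟩ := H.KC_WD hκ
  refine hk.hasFDerivAt_Jt hκ hk' (fun x τ hτ s hs => ?_) x ht
  exact hasFDerivAt_Iav (AD_gam n) AD_gamD gamD_cont hasFDerivAt_gam (H.slice hs) hκ (H.EB hs) x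
    (Real.sqrt_pos.2 hτ.1)

lemma WD_apply (hκ : 0 ≤ κ) (H : HC T C κ h) (x : E n) {t : ℝ} (ht : t ∈ Ioo 0 T) (i : Fin n) :
    WD h x t (ee i) = Wi i h x t := by
  obtain ⟨C₂, hk'⟩ := H.KC_WD hκ
  rw [WD, Jt, ContinuousLinearMap.integral_apply (hk'.integrableOn x ht), Wi, Jt]
  refine setIntegral_congr_fun measurableSet_Ioo fun s hs => ?_
  have hs' : s ∈ Ioo 0 T := ⟨hs.1, hs.2.trans ht.2⟩
  simp only [smul_apply]
  rw [Iav, ContinuousLinearMap.integral_apply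
    (integrable_Iav AD_gamD gamD_cont (H.slice hs') hκ (H.EB hs') x _), Iav]
  simp only [smul_apply, gamD_apply]

/-- gradient data -/
structure HG (T C κ : ℝ) (g : E n → ℝ → ℝ) (g' : E n → ℝ → (E n →L[ℝ] ℝ)) : Prop where
  hc : HC T C κ g
  der : ∀ y, ∀ s ∈ Ioo 0 T, HasFDerivAt (fun y => g y s) (g' y s) y
  cont : ContinuousOn (fun p : E n × ℝ => g' p.1 p.2) (univ ×ˢ Ioo 0 T)
  bd : ∀ y, ∀ s ∈ Ioo 0 T, ‖g' y s‖ ≤ C * (√s)⁻¹ * Real.exp (κ * ‖y‖)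

variable {g : E n → ℝ → ℝ} {g' : E n → ℝ → (E n →L[ℝ] ℝ)}

lemma HG.comp (H : HG T C κ g g') (i : Fin n) : HC T C κ (fun y s => g' y s (ee i)) where
  cont := H.cont.clm_apply continuousOn_const
  bd := fun y s hs => by
    refine le_trans ?_ (H.bd y s hs)
    simpa using (g' y s).le_opNorm (ee i)

lemma HG.slice (H : HG T C κ g g') {s : ℝ} (hs : s ∈ Ioo 0 T) : Continuous (fun y => g' y s) := by
  rw [← continuousOn_univ]
  exact H.cont.comp (f := fun y => (y, s)) (by fun_prop) (fun y _ => ⟨mem_univ _, hs⟩)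

lemma HG.ebd (H : HG T C κ g g') {s : ℝ} (hs : s ∈ Ioo 0 T) : EB (C * (√s)⁻¹) κ (fun y => ‖g' y s‖) :=
  fun y => by rw [abs_norm]; exact H.bd y s hs

lemma Wi_eq_W (hκ : 0 ≤ κ) (H : HG T C κ g g') (x : E n) {t : ℝ} (ht : t ∈ Ioo 0 T) (i : Fin n) :
    Wi i g x t = Wop (fun y s => g' y s (ee i)) x t := by
  rw [Wi, Wop, Jt, Jt]
  refine setIntegral_congr_fun measurableSet_Ioo fun s hs => ?_
  have hs' : s ∈ Ioo 0 T := ⟨hs.1, hs.2.trans ht.2⟩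
  have := Iav_ibp (AD_gam n) AD_gamD gamD_cont hasFDerivAt_gam (fun y => H.der y s hs') (H.slice hs') hκ
    (H.hc.EB hs') (H.ebd hs') x √(t - s) i
  simp only [gamD_apply] at this
  have h1 : 0 < √(t - s) := Real.sqrt_pos.2 (by linarith [hs.2])
  change -(√(t - s))⁻¹ • Iav (fun z => gami n i z) (fun y => g y s) x √(t - s) = _
  rw [this, smul_eq_mul]
  field_simp

lemma Iav_zero (f : E n → ℝ) (x : E n) : Iav (gam n) f x 0 = f x := by
  simp only [Iav, zero_smul, add_zero]
  rw [integral_smul, integral_gam]; simp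

lemma W_hasDerivAt (hκ : 0 ≤ κ) (H : HG T C κ g g') (x : E n) {t₀ : ℝ} (ht₀ : t₀ ∈ Ioo 0 T) :
    HasDerivAt (fun t => Wop g x t) (g x t₀ + ∑ i, Wi i (fun y s => g' y s (ee i)) x t₀) t₀ := by
  have hT : 0 < T := ht₀.1.trans ht₀.2
  choose Ci hki using fun i => (H.comp i).KC_Wi hκ i
  have hQ := KC.sum hki
  set Q : E n → ℝ → ℝ → ℝ := fun x τ s => ∑ i, (-(√τ)⁻¹) • Iav (gami n i) (fun y => g' y s (ee i)) x √τ with hQdef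
  have hCQ := hQ.nonneg hT
  have hJQ : ∀ t ∈ Ioo 0 T, Jt Q x t = ∑ i, Wi i (fun y s => g' y s (ee i)) x t := by
    intro t ht
    simp only [Jt, hQdef, Wi]
    exact integral_finsetSum _ fun i _ => (hki i).integrableOn x ht
  have hsw := fun t (ht : t ∈ Ioo 0 T) => triangle_swap (C := (∑ i, Ci i) * rexp (κ * ‖x‖)) (q := fun τ s => Q x τ s) ht
    (hQ.cont.comp (f := fun p : ℝ × ℝ => (x, p.1, p.2)) (by fun_prop) (fun p hp => ⟨mem_univ _, hp.1, hp.2⟩))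
    (fun τ hτ s hs => hQ.bd x τ hτ s hs)
  have hgc : ContinuousOn (fun s => g x s) (Ioo 0 T) :=
    H.hc.cont.comp (f := fun s => (x, s)) (by fun_prop) (fun s hs => ⟨mem_univ _, hs⟩)
  have hgint : ∀ t ∈ Ioo 0 T, IntegrableOn (fun s => g x s) (Ioo 0 t) := by
    intro t ht
    refine ((inv_sqrt_integrableOn ht.1).const_mul (C * rexp (κ * ‖x‖))).mono'
      ((hgc.mono (Ioo_subset_Ioo_right ht.2.le)).aestronglyMeasurable measurableSet_Ioo) ?_
    refine (ae_restrict_iff' measurableSet_Ioo).2 (ae_of_all _ fun s hs => ?_)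
    refine (H.hc.bd x s ⟨hs.1, hs.2.trans ht.2⟩).trans (le_of_eq (by ring))
  have hJc : ContinuousOn (fun t => Jt Q x t) (Ioo 0 T) :=
    (hQ.continuousOn_Jt hκ).comp (f := fun s => (x, s)) (by fun_prop) (fun s hs => ⟨mem_univ _, hs⟩)
  have hJint : ∀ t ∈ Ioo 0 T, IntegrableOn (fun s => Jt Q x s) (Ioo 0 t) := by
    intro t ht
    refine (integrableOn_const (C := (∑ i, Ci i) * betaB * rexp (κ * ‖x‖)) (by simp)).mono'
      ((hJc.mono (Ioo_subset_Ioo_right ht.2.le)).aestronglyMeasurable measurableSet_Ioo) ?_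
    refine (ae_restrict_iff' measurableSet_Ioo).2 (ae_of_all _ fun s hs => ?_)
    exact hQ.norm_Jt_le x ⟨hs.1, hs.2.trans ht.2⟩
  -- FTC in τ
  have hftc : ∀ t ∈ Ioo 0 T, ∀ s ∈ Ioo 0 t, Iav (gam n) (fun y => g y s) x √(t - s) =
      g x s + ∫ τ in Ioo 0 (t - s), Q x τ s := by
    intro t ht s hs
    have hs' : s ∈ Ioo 0 T := ⟨hs.1, hs.2.trans ht.2⟩
    have hd := fun r => hasDerivAt_Iav_scale' (AD_gam n) (gam_cont n) (fun y => H.der y s hs') (H.slice hs') hκ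
      (H.hc.EB hs') (H.ebd hs') x r
    have hts : 0 < t - s := by linarith [hs.2]
    have := intervalIntegral.integral_eq_sub_of_hasDerivAt_of_le (a := 0) (b := t - s)
      (f := fun τ => Iav (gam n) (fun y => g y s) x √τ) (f' := fun τ => Q x τ s) hts.le ?_ ?_ ?_
    · rw [← integral_Ioc_eq_integral_Ioo, ← intervalIntegral.integral_of_le hts.le, this,
        Real.sqrt_zero, Iav_zero]
      ring
    · have hc : Continuous (fun r => Iav (gam n) (fun y => g y s) x r) :=
        continuous_iff_continuousAt.2 fun r => (hd r).continuousAt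
      exact (hc.comp Real.continuous_sqrt).continuousOn
    · intro τ hτ
      have h1 : 0 < √τ := Real.sqrt_pos.2 hτ.1
      refine ((hd √τ).comp τ (Real.hasDerivAt_sqrt hτ.1.ne')).congr_deriv ?_
      rw [hQdef, Finset.sum_mul]
      refine Finset.sum_congr rfl fun i _ => ?_
      have : Iav (gami n i) (fun y => g' y s (ee i)) x √τ = -(1/2) * Iav (fun z => z i * gam n z) (fun y => g' y s (ee i)) x √τ := by
        simp only [Iav, ← integral_const_mul, gami, smul_eq_mul]
        congr 1; ext z; ring
      rw [this, smul_eq_mul]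
      field_simp
    · rw [intervalIntegrable_iff_integrableOn_Ioo_of_le hts.le]
      have hsub : Ioo 0 (t - s) ⊆ Ioo 0 T := Ioo_subset_Ioo_right (by linarith [ht.2, hs.1])
      have hqc : ContinuousOn (fun τ => Q x τ s) (Ioo 0 T) :=
        hQ.cont.comp (f := fun τ => (x, τ, s)) (by fun_prop) (fun τ hτ => ⟨mem_univ _, hτ, hs'⟩)
      refine ((inv_sqrt_integrableOn hts).const_mul ((∑ i, Ci i) * rexp (κ * ‖x‖) * (√s)⁻¹)).mono'
        ((hqc.mono hsub).aestronglyMeasurable measurableSet_Ioo) ?_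
      refine (ae_restrict_iff' measurableSet_Ioo).2 (ae_of_all _ fun τ hτ => ?_)
      exact (hQ.bd x τ (hsub hτ) s hs').trans (le_of_eq (by ring))
  have hW : ∀ t ∈ Ioo 0 T, Wop g x t = (∫ s in (0:ℝ)..t, g x s) + ∫ s in (0:ℝ)..t, Jt Q x s := by
    intro t ht
    rw [Wop, Jt, setIntegral_congr_fun measurableSet_Ioo (hftc t ht), integral_add (hgint t ht) (hsw t ht).1,
      (hsw t ht).2, intervalIntegral.integral_of_le ht.1.le, intervalIntegral.integral_of_le ht.1.le,
      integral_Ioc_eq_integral_Ioo, integral_Ioc_eq_integral_Ioo]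
    rfl
  have hev : (fun t => Wop g x t) =ᶠ[𝓝 t₀] fun t => (∫ s in (0:ℝ)..t, g x s) + ∫ s in (0:ℝ)..t, Jt Q x s := by
    filter_upwards [Ioo_mem_nhds ht₀.1 ht₀.2] with t ht using hW t ht
  refine HasDerivAt.congr_of_eventuallyEq ?_ hev
  rw [← hJQ t₀ ht₀]
  refine HasDerivAt.add ?_ ?_
  · refine intervalIntegral.integral_hasDerivAt_right ?_ (hgc.stronglyMeasurableAtFilter isOpen_Ioo t₀ ht₀)
      (isOpen_Ioo.continuousOn_iff.1 hgc ht₀)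
    rw [intervalIntegrable_iff_integrableOn_Ioo_of_le ht₀.1.le]; exact hgint t₀ ht₀
  · refine intervalIntegral.integral_hasDerivAt_right ?_ (hJc.stronglyMeasurableAtFilter isOpen_Ioo t₀ ht₀)
      (isOpen_Ioo.continuousOn_iff.1 hJc ht₀)
    rw [intervalIntegrable_iff_integrableOn_Ioo_of_le ht₀.1.le]; exact hJint t₀ ht₀

end

end

section
section
variable {n : ℕ}

def qq (b : ℝ) (y : E n) (s : ℝ) : ℝ := 1 + ‖y‖ ^ 2 + b * s

lemma one_le_qq {b s : ℝ} (hb : 0 ≤ b) (hs : 0 ≤ s) (y : E n) : 1 ≤ qq b y s := by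
  have := mul_nonneg hb hs
  have := sq_nonneg ‖y‖
  unfold qq; linarith

lemma sq_le_qq {b s : ℝ} (hb : 0 ≤ b) (hs : 0 ≤ s) (y : E n) : ‖y‖ ^ 2 ≤ qq b y s := by
  have := mul_nonneg hb hs
  unfold qq; linarith

lemma norm_le_qq {b s : ℝ} (hb : 0 ≤ b) (hs : 0 ≤ s) (y : E n) : ‖y‖ ≤ qq b y s := by
  have := mul_nonneg hb hs
  unfold qq; nlinarith [sq_nonneg (‖y‖ - 1)]

lemma qq_rpow_le {b s T α : ℝ} (hb : 0 ≤ b) (hs : 0 ≤ s) (hsT : s ≤ T) (hα : 0 ≤ α) (y : E n) :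
    qq b y s ^ α ≤ (2 * (1 + b * T)) ^ α * Real.exp (α * ‖y‖) := by
  have h1 : 1 + ‖y‖ ^ 2 ≤ 2 * Real.exp ‖y‖ := by
    have := Real.quadratic_le_exp_of_nonneg (norm_nonneg y)
    nlinarith [norm_nonneg y]
  have hbT : b * s ≤ b * T := by gcongr
  have hbs := mul_nonneg hb hs
  have h2 : qq b y s ≤ (2 * (1 + b * T)) * Real.exp ‖y‖ := by
    have h3 : qq b y s ≤ (1 + b * T) * (1 + ‖y‖ ^ 2) := by
      unfold qq; nlinarith [sq_nonneg ‖y‖, mul_nonneg (hbs.trans hbT) (sq_nonneg ‖y‖)]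
    have h4 : (1 + b * T) * (1 + ‖y‖ ^ 2) ≤ (1 + b * T) * (2 * Real.exp ‖y‖) := by
      apply mul_le_mul_of_nonneg_left h1; linarith
    linarith
  have h0 := one_le_qq hb hs y
  calc qq b y s ^ α ≤ ((2 * (1 + b * T)) * Real.exp ‖y‖) ^ α := Real.rpow_le_rpow (by linarith) h2 hα
    _ = _ := by rw [Real.mul_rpow (by linarith) (Real.exp_pos _).le, ← Real.exp_mul, mul_comm α]

lemma hasFDerivAt_qq_rpow {b s : ℝ} (hb : 0 ≤ b) (hs : 0 ≤ s) (β : ℝ) (y : E n) :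
    HasFDerivAt (fun y => qq b y s ^ β) ((2 * β * qq b y s ^ (β - 1)) • innerSL ℝ y) y := by
  have h0 := one_le_qq hb hs y
  have h1 : HasFDerivAt (fun y : E n => qq b y s) (2 • innerSL ℝ y) y := by
    have := ((hasStrictFDerivAt_norm_sq y).hasFDerivAt.const_add 1).add_const (b * s)
    exact this
  refine (h1.rpow_const (p := β) (Or.inl (by linarith))).congr_fderiv ?_
  ext v
  simp
  ring

/-- i-th partial derivative of qq^α -/
def qi (α b : ℝ) (i : Fin n) (y : E n) (s : ℝ) : ℝ := 2 * α * qq b y s ^ (α - 1) * y i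

def qiD (α b : ℝ) (i : Fin n) (y : E n) (s : ℝ) : E n →L[ℝ] ℝ :=
  (2 * α * qq b y s ^ (α - 1)) • EuclideanSpace.proj i +
    (y i * (2 * α * (2 * (α - 1) * qq b y s ^ (α - 2)))) • innerSL ℝ y

lemma hasFDerivAt_qi {α b s : ℝ} (hb : 0 ≤ b) (hs : 0 ≤ s) (i : Fin n) (y : E n) :
    HasFDerivAt (fun y => qi α b i y s) (qiD α b i y s) y := by
  have h1 := (hasFDerivAt_qq_rpow hb hs (α - 1) y).const_mul (2 * α)
  have h2 : HasFDerivAt (fun y : E n => y i) (EuclideanSpace.proj i : E n →L[ℝ] ℝ) y :=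
    (EuclideanSpace.proj i : E n →L[ℝ] ℝ).hasFDerivAt
  refine (h1.mul h2).congr_fderiv ?_
  rw [show α - 1 - 1 = α - 2 by ring]
  ext v
  simp [qiD]
  ring

lemma qq_cont_rpow {b : ℝ} (hb : 0 ≤ b) (β : ℝ) :
    ContinuousOn (fun p : E n × ℝ => qq b p.1 p.2 ^ β) (univ ×ˢ Ici 0) := by
  refine ContinuousOn.rpow_const (by unfold qq; fun_prop) fun p hp => Or.inl ?_
  have := one_le_qq hb hp.2 p.1
  linarith

lemma qq_slice {b s : ℝ} (hb : 0 ≤ b) (hs : 0 ≤ s) (β : ℝ) : Continuous (fun y : E n => qq b y s ^ β) :=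
  continuous_iff_continuousAt.2 fun y => (hasFDerivAt_qq_rpow hb hs β y).continuousAt

lemma qi_slice {α b s : ℝ} (hb : 0 ≤ b) (hs : 0 ≤ s) (i : Fin n) : Continuous (fun y : E n => qi α b i y s) :=
  continuous_iff_continuousAt.2 fun y => (hasFDerivAt_qi hb hs i y).continuousAt

lemma qiD_slice {α b s : ℝ} (hb : 0 ≤ b) (hs : 0 ≤ s) (i : Fin n) : Continuous (fun y : E n => qiD α b i y s) := by
  unfold qiD
  have h1 := qq_slice (n := n) hb hs (α - 1)
  have h2 := qq_slice (n := n) hb hs (α - 2)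
  have h3 : Continuous (fun y : E n => innerSL ℝ y) := (innerSL ℝ).continuous
  fun_prop

lemma qq_rpow_sub_one {b s α : ℝ} (hb : 0 ≤ b) (hs : 0 ≤ s) (y : E n) :
    qq b y s ^ (α - 1) * qq b y s = qq b y s ^ α := by
  have h0 := one_le_qq hb hs y
  rw [Real.rpow_sub_one (by linarith)]; field_simp

lemma qq_rpow_sub_two {b s α : ℝ} (hb : 0 ≤ b) (hs : 0 ≤ s) (y : E n) :
    qq b y s ^ (α - 2) * qq b y s = qq b y s ^ (α - 1) := by
  rw [← qq_rpow_sub_one (α := α - 1) hb hs]; congr 2; ring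

lemma abs_qi_le {α b s : ℝ} (hb : 0 ≤ b) (hs : 0 ≤ s) (hα : 0 ≤ α) (i : Fin n) (y : E n) :
    |qi α b i y s| ≤ 2 * α * qq b y s ^ α := by
  have h0 := one_le_qq hb hs y
  have hp : 0 ≤ qq b y s ^ (α - 1) := Real.rpow_nonneg (by linarith) _
  rw [qi, abs_mul, abs_of_nonneg (by positivity), ← qq_rpow_sub_one (α := α) hb hs, mul_assoc (2 * α)]
  gcongr
  exact (abs_coord_le y i).trans (norm_le_qq hb hs y)

lemma norm_qiD_le {α b s : ℝ} (hb : 0 ≤ b) (hs : 0 ≤ s) (hα : 0 ≤ α) (i : Fin n) (y : E n) :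
    ‖qiD α b i y s‖ ≤ (2 * α + 4 * α * |α - 1|) * qq b y s ^ α := by
  have h0 := one_le_qq hb hs y
  have hp : 0 ≤ qq b y s ^ (α - 1) := Real.rpow_nonneg (by linarith) _
  have hp2 : 0 ≤ qq b y s ^ (α - 2) := Real.rpow_nonneg (by linarith) _
  have h1 : ‖(EuclideanSpace.proj i : E n →L[ℝ] ℝ)‖ ≤ 1 :=
    ContinuousLinearMap.opNorm_le_bound _ zero_le_one fun z => by simpa using abs_coord_le z i
  have hle : qq b y s ^ (α - 1) ≤ qq b y s ^ α := Real.rpow_le_rpow_of_exponent_le h0 (by linarith)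
  refine (norm_add_le _ _).trans ?_
  rw [norm_smul, norm_smul, innerSL_apply_norm, Real.norm_eq_abs, Real.norm_eq_abs, add_mul]
  refine add_le_add ?_ ?_
  · rw [abs_of_nonneg (by positivity)]
    calc _ ≤ 2 * α * qq b y s ^ (α - 1) * 1 := by gcongr
      _ ≤ _ := by rw [mul_one]; gcongr
  · have : |y i * (2 * α * (2 * (α - 1) * qq b y s ^ (α - 2)))| = |y i| * (4 * α * |α - 1| * qq b y s ^ (α - 2)) := by
      rw [abs_mul, abs_mul, abs_mul, abs_mul (2 * (α - 1)), abs_mul 2 (α-1), abs_of_nonneg hp2, abs_of_nonneg hα, abs_two]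
      norm_num; ring_nf; simp
    rw [this]
    calc _ ≤ ‖y‖ * (4 * α * |α - 1| * qq b y s ^ (α - 2)) * ‖y‖ := by
            gcongr; exact abs_coord_le y i
      _ = 4 * α * |α - 1| * (qq b y s ^ (α - 2) * ‖y‖ ^ 2) := by ring
      _ ≤ 4 * α * |α - 1| * (qq b y s ^ (α - 2) * qq b y s) := by gcongr; exact sq_le_qq hb hs y
      _ ≤ _ := by rw [qq_rpow_sub_two hb hs]; gcongr

/-- (∂_t - Δ) qq^α -/
def qG (α b : ℝ) (y : E n) (s : ℝ) : ℝ :=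
  α * b * qq b y s ^ (α - 1) - ∑ i, qiD α b i y s (ee i)

lemma qG_eq {α b s : ℝ} (y : E n) : qG α b y s = α * b * qq b y s ^ (α - 1) -
    (2 * α * n * qq b y s ^ (α - 1) + 4 * α * (α - 1) * qq b y s ^ (α - 2) * ‖y‖ ^ 2) := by
  have h : ‖y‖ ^ 2 = ∑ i, y i ^ 2 := by
    rw [EuclideanSpace.norm_sq_eq]; simp
  rw [qG, h]
  congr 1
  have : ∀ i, qiD α b i y s (ee i) = 2 * α * qq b y s ^ (α - 1) +
      4 * α * (α - 1) * qq b y s ^ (α - 2) * y i ^ 2 := by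
    intro i
    have : inner ℝ y (ee i) = y i := by
      rw [EuclideanSpace.inner_single_right]; simp
    simp only [qiD, add_apply, smul_apply, innerSL_apply_apply, this]
    simp
    ring
  simp only [this, Finset.sum_add_distrib, ← Finset.mul_sum]
  simp; ring

lemma qG_slice {α b s : ℝ} (hb : 0 ≤ b) (hs : 0 ≤ s) : Continuous (fun y : E n => qG α b y s) := by
  unfold qG
  have h1 := qq_slice (n := n) hb hs (α - 1)
  have h2 := fun i => qiD_slice (n := n) (α := α) hb hs i
  refine Continuous.sub (by fun_prop) (continuous_finsetSum _ fun i _ => ?_)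
  exact (h2 i).clm_apply continuous_const

/-- path function of the barrier -/
def qphi (α b : ℝ) (x : E n) (t σ : ℝ) : ℝ := Iav (gam n) (fun y => qq b y σ ^ α) x √(t - σ)

lemma qphi_bound {α b t σ : ℝ} (hb : 0 ≤ b) (hα : 0 ≤ α) (hσ : σ ∈ Icc 0 t) (x z : E n) :
    qq b (x + √(t - σ) • z) σ ^ α ≤ (2 * (1 + b * t)) ^ α * Real.exp (α * ‖x‖) * Real.exp (α * √t * ‖z‖) := by
  refine (qq_rpow_le hb hσ.1 hσ.2 hα _).trans ?_
  have h0 : 0 ≤ b * t := mul_nonneg hb (hσ.1.trans hσ.2)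
  rw [mul_assoc, ← Real.exp_add]
  gcongr
  calc α * ‖x + √(t - σ) • z‖ ≤ α * (‖x‖ + √t * ‖z‖) := by
        gcongr
        refine (norm_add_le _ _).trans ?_
        rw [norm_smul, Real.norm_eq_abs, abs_of_nonneg (Real.sqrt_nonneg _)]
        gcongr
        linarith [hσ.1]
    _ = _ := by ring

lemma qphi_cont {α b t : ℝ} (hb : 0 ≤ b) (hα : 0 ≤ α) (x : E n) :
    ContinuousOn (qphi α b x t) (Icc 0 t) := by
  have key := ((AD_gam n).integrable_exp (gam_cont n) (α * √t)).const_mul ((2 * (1 + b * t)) ^ α * Real.exp (α * ‖x‖))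
  refine continuousOn_of_dominated (F := fun σ z => (qq b (x + √(t - σ) • z) σ ^ α) • gam n z) ?_ ?_ key ?_
  · intro σ hσ
    have := qq_slice (n := n) hb hσ.1 α
    have h2 := gam_cont n
    exact Continuous.aestronglyMeasurable ((this.comp (g := fun y => qq b y σ ^ α) (f := fun z => x + √(t - σ) • z) (by fun_prop)).smul h2)
  · intro σ hσ
    refine ae_of_all _ fun z => ?_
    have h0 := one_le_qq hb hσ.1 (x + √(t - σ) • z)
    rw [norm_smul, Real.norm_eq_abs, abs_of_nonneg (Real.rpow_nonneg (by linarith) _), ← mul_assoc]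
    gcongr
    exact qphi_bound hb hα hσ x z
  · refine ae_of_all _ fun z => ?_
    refine ContinuousOn.fun_smul ?_ continuousOn_const
    exact (qq_cont_rpow (n := n) hb α).comp (f := fun σ => (x + √(t - σ) • z, σ)) (by fun_prop)
      (fun σ hσ => ⟨mem_univ _, hσ.1⟩)

lemma qpath_deriv {α b t σ : ℝ} (hb : 0 ≤ b) (hσ : σ ∈ Ioo 0 t) (x z : E n) :
    HasDerivAt (fun σ => qq b (x + √(t - σ) • z) σ ^ α)
      (α * b * qq b (x + √(t - σ) • z) σ ^ (α - 1) -
        (2 * √(t - σ))⁻¹ * ∑ i, z i * qi α b i (x + √(t - σ) • z) σ) σ := by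
  have hts : 0 < t - σ := by linarith [hσ.2]
  have h1 : HasDerivAt (fun σ => √(t - σ)) (-(2 * √(t - σ))⁻¹) σ := by
    have := ((hasDerivAt_id σ).const_sub t).sqrt hts.ne'
    refine this.congr_deriv ?_
    simp [div_eq_mul_inv]
  have h2 : HasDerivAt (fun σ => x + √(t - σ) • z) ((-(2 * √(t - σ))⁻¹) • z) σ := (h1.smul_const z).const_add x
  have h3 := (h2.norm_sq.const_add 1).add ((hasDerivAt_id σ).const_mul b)
  have h4 : HasDerivAt (fun σ => qq b (x + √(t - σ) • z) σ) _ σ := h3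
  have h0 := one_le_qq hb hσ.1.le (x + √(t - σ) • z)
  refine (h4.rpow_const (p := α) (Or.inl (by linarith))).congr_deriv ?_
  have hs : ∑ i, z i * qi α b i (x + √(t - σ) • z) σ =
      2 * α * qq b (x + √(t - σ) • z) σ ^ (α - 1) * inner ℝ (x + √(t - σ) • z) z := by
    rw [PiLp.inner_apply, Finset.mul_sum]
    refine Finset.sum_congr rfl fun i _ => ?_
    simp [qi]; ring
  rw [hs, inner_smul_right]
  simp only [mul_one]
  ring

lemma norm_le_two_exp (z : E n) : ‖z‖ ≤ Real.exp ‖z‖ := by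
  linarith [Real.add_one_le_exp ‖z‖]

lemma qphi_deriv {α b t s : ℝ} (hb : 0 ≤ b) (hα : 0 ≤ α) (hs : s ∈ Ioo 0 t) (x : E n) :
    HasDerivAt (qphi α b x t) (Iav (gam n) (fun y => qG α b y s) x √(t - s)) s := by
  have hts : 0 < t - s := by linarith [hs.2]
  have hst : 0 < √(t - s) := Real.sqrt_pos.2 hts
  have hbt : 0 ≤ b * t := mul_nonneg hb (by linarith [hs.1, hs.2])
  set s₁ := (s + t) / 2 with hs₁
  have hs₁t : 0 < t - s₁ := by rw [hs₁]; linarith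
  set c := (2 * √(t - s₁))⁻¹ with hc
  have hc0 : 0 ≤ c := by positivity
  set M := (2 * (1 + b * t)) ^ α * Real.exp (α * ‖x‖) with hM
  have hM0 : 0 ≤ M := by positivity
  have key := (((AD_gam n).integrable_exp (gam_cont n) (α * √t + 1)).const_mul ((α * b + c * (n * (2 * α))) * M))
  have hmain := hasDerivAt_integral_of_dominated_loc_of_deriv_le (μ := volume) (x₀ := s) (s := Ioo 0 s₁)
    (F := fun σ z => (qq b (x + √(t - σ) • z) σ ^ α) • gam n z)
    (F' := fun σ z => (α * b * qq b (x + √(t - σ) • z) σ ^ (α - 1) -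
        (2 * √(t - σ))⁻¹ * ∑ i, z i * qi α b i (x + √(t - σ) • z) σ) • gam n z)
    (Ioo_mem_nhds hs.1 (by rw [hs₁]; linarith)) ?_ ?_ ?_ ?_ key ?_
  · refine HasDerivAt.congr_deriv (f := qphi α b x t) hmain.2 ?_
    set B := (2 * (1 + b * t)) ^ α with hB
    have hB0 : 0 ≤ B := by positivity
    set r := √(t - s) with hr
    have hq0 : ∀ (y : E n), 0 ≤ qq b y s ^ α := fun y => Real.rpow_nonneg (by linarith [one_le_qq hb hs.1.le y]) _
    have hqb : ∀ (y : E n), qq b y s ^ α ≤ B * Real.exp (α * ‖y‖) := fun y => qq_rpow_le hb hs.1.le hs.2.le hα y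
    have hC0 : 0 ≤ 4 * α * |α - 1| := by positivity
    have hEBi : ∀ i, EB ((2 * α + 4 * α * |α - 1|) * B) α (fun y : E n => qi α b i y s) := by
      intro i y
      refine (abs_qi_le hb hs.1.le hα i y).trans ?_
      rw [mul_assoc (2 * α + _) B]
      exact mul_le_mul (by linarith) (hqb y) (hq0 y) (by positivity)
    have hEBD : ∀ i, EB ((2 * α + 4 * α * |α - 1|) * B) α (fun y : E n => ‖qiD α b i y s‖) := by
      intro i y
      rw [abs_norm]
      refine (norm_qiD_le hb hs.1.le hα i y).trans ?_
      rw [mul_assoc (2 * α + _) B]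
      exact mul_le_mul_of_nonneg_left (hqb y) (by positivity)
    have hEBDi : ∀ i, EB ((2 * α + 4 * α * |α - 1|) * B) α (fun y : E n => qiD α b i y s (ee i)) := by
      intro i y
      refine le_trans ?_ (hEBD i y)
      rw [abs_norm]
      simpa using (qiD α b i y s).le_opNorm (ee i)
    have hEB1 : EB (α * b * B) α (fun y : E n => α * b * qq b y s ^ (α - 1)) := by
      intro y
      have h0 := one_le_qq hb hs.1.le y
      have h1 : 0 ≤ qq b y s ^ (α - 1) := Real.rpow_nonneg (by linarith) _
      rw [abs_of_nonneg (by positivity), mul_assoc (α * b) B]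
      refine mul_le_mul_of_nonneg_left ?_ (by positivity)
      exact (Real.rpow_le_rpow_of_exponent_le h0 (by linarith)).trans (hqb y)
    have hi1 := integrable_Iav (AD_gam n) (gam_cont n) ((qq_slice (n := n) hb hs.1.le (α - 1)).const_mul (α * b)) hα hEB1 x r
    have hi2 := fun i => integrable_Iav ((AD_gam n).coord_mul i) (by have := gam_cont n; fun_prop)
      (qi_slice (n := n) (α := α) hb hs.1.le i) hα (hEBi i) x r
    have hi3 := fun i => integrable_Iav (AD_gam n) (gam_cont n)
      ((qiD_slice (n := n) (α := α) hb hs.1.le i).clm_apply (continuous_const (y := ee i))) hα (hEBDi i) x r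
    have e1 : (fun z => (α * b * qq b (x + r • z) s ^ (α - 1) -
        (2 * r)⁻¹ * ∑ i, z i * qi α b i (x + r • z) s) • gam n z) =
        fun z => (α * b * qq b (x + r • z) s ^ (α - 1)) • gam n z -
          (2 * r)⁻¹ * ∑ i, (qi α b i (x + r • z) s) • (z i * gam n z) := by
      ext z
      simp only [smul_eq_mul]
      rw [sub_mul, mul_assoc (2 * r)⁻¹, Finset.sum_mul]
      congr 2
      exact Finset.sum_congr rfl fun i _ => by ring
    have e2 : Iav (gam n) (fun y => qG α b y s) x r = ∫ z, ((α * b * qq b (x + r • z) s ^ (α - 1)) • gam n z -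
          ∑ i, (qiD α b i (x + r • z) s (ee i)) • gam n z) := by
      rw [Iav]
      congr 1; ext z
      rw [qG, sub_smul, Finset.sum_smul]
    rw [e1, e2, integral_sub hi1 ((integrable_finsetSum _ fun i _ => hi2 i).const_mul _),
      integral_sub hi1 (integrable_finsetSum _ fun i _ => hi3 i), integral_const_mul,
      integral_finsetSum _ (fun i _ => hi2 i), integral_finsetSum _ (fun i _ => hi3 i), Finset.mul_sum]
    congr 1
    refine Finset.sum_congr rfl fun i _ => ?_
    have hibp := Iav_ibp (AD_gam n) AD_gamD gamD_cont hasFDerivAt_gam (fun y => hasFDerivAt_qi (α := α) hb hs.1.le i y)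
      (qiD_slice hb hs.1.le i) hα (hEBi i) (hEBD i) x r i
    simp only [gamD_apply, gami, Iav] at hibp
    have e3 : ∫ z, qi α b i (x + r • z) s • (z i * gam n z) = -2 * ∫ z, qi α b i (x + r • z) s • (-(1/2) * z i * gam n z) := by
      rw [← integral_const_mul]
      congr 1; ext z; simp only [smul_eq_mul]; ring
    rw [e3, hibp]
    field_simp
  · filter_upwards [Ioo_mem_nhds hs.1 hs.2] with σ hσ
    have := qq_slice (n := n) hb hσ.1.le α
    have h2 := gam_cont n
    exact Continuous.aestronglyMeasurable ((this.comp (g := fun y => qq b y σ ^ α) (f := fun z => x + √(t - σ) • z) (by fun_prop)).smul h2)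
  · have hEB : EB ((2 * (1 + b * t)) ^ α) α (fun y : E n => qq b y s ^ α) := by
      intro y
      have h0 := one_le_qq hb hs.1.le y
      rw [abs_of_nonneg (Real.rpow_nonneg (by linarith) _)]
      exact qq_rpow_le hb hs.1.le hs.2.le hα y
    exact integrable_Iav (AD_gam n) (gam_cont n) (qq_slice hb hs.1.le α) hα hEB x _
  · have h1 := qq_slice (n := n) hb hs.1.le (α - 1)
    have h2 := fun i => qi_slice (n := n) (α := α) hb hs.1.le i
    have h3 := gam_cont n
    have h4 : Continuous (fun z : E n => x + √(t - s) • z) := by fun_prop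
    have h5 : Continuous (fun z : E n => qq b (x + √(t - s) • z) s ^ (α - 1)) := h1.comp h4
    have h6 : ∀ i, Continuous (fun z : E n => qi α b i (x + √(t - s) • z) s) := fun i => (h2 i).comp h4
    refine Continuous.aestronglyMeasurable (Continuous.smul (Continuous.sub (continuous_const.mul h5)
      (continuous_const.mul (continuous_finsetSum _ fun i _ => Continuous.mul (by fun_prop) (h6 i)))) h3)
  · refine ae_of_all _ fun z σ hσ => ?_
    have hσt : σ ∈ Icc 0 t := ⟨hσ.1.le, by linarith [hσ.2]⟩
    have h0 := one_le_qq hb hσ.1.le (x + √(t - σ) • z)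
    rw [norm_smul, Real.norm_eq_abs (gam n z), abs_of_pos (gam_pos n z), ← mul_assoc]
    refine mul_le_mul_of_nonneg_right ?_ (gam_pos n z).le
    set Q := qq b (x + √(t - σ) • z) σ with hQ
    have hQb : Q ^ α ≤ M * Real.exp (α * √t * ‖z‖) := qphi_bound hb hα hσt x z
    have hQ0 : 0 ≤ Q ^ (α - 1) := Real.rpow_nonneg (by linarith) _
    have hQ00 : 0 ≤ Q ^ α := Real.rpow_nonneg (by linarith) _
    have hQ1 : Q ^ (α - 1) ≤ Q ^ α := Real.rpow_le_rpow_of_exponent_le h0 (by linarith)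
    have hz1 : ‖z‖ ≤ Real.exp ‖z‖ := norm_le_two_exp z
    have hz2 : 1 ≤ Real.exp ‖z‖ := Real.one_le_exp (norm_nonneg z)
    have hcc : (2 * √(t - σ))⁻¹ ≤ c := by
      rw [hc]
      have : 0 < √(t - s₁) := Real.sqrt_pos.2 hs₁t
      gcongr
      exact hσ.2.le
    have hsum : |∑ i, z i * qi α b i (x + √(t - σ) • z) σ| ≤ n * (2 * α) * (Real.exp ‖z‖ * Q ^ α) := by
      refine (Finset.abs_sum_le_sum_abs _ _).trans ?_
      calc _ ≤ ∑ i : Fin n, Real.exp ‖z‖ * (2 * α * Q ^ α) := by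
            refine Finset.sum_le_sum fun i _ => ?_
            rw [abs_mul]
            gcongr
            · exact (abs_coord_le z i).trans hz1
            · exact abs_qi_le hb hσ.1.le hα i _
        _ = _ := by simp; ring
    refine (norm_sub_le _ _).trans ?_
    rw [Real.norm_eq_abs, Real.norm_eq_abs, abs_mul (2 * √(t - σ))⁻¹, abs_of_nonneg (by positivity),
      abs_of_nonneg (a := (2 * √(t - σ))⁻¹) (by positivity)]
    calc _ ≤ α * b * (Real.exp ‖z‖ * Q ^ α) + c * (n * (2 * α) * (Real.exp ‖z‖ * Q ^ α)) := by
          gcongr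
          nlinarith
      _ = (α * b + c * (n * (2 * α))) * Real.exp ‖z‖ * Q ^ α := by ring
      _ ≤ (α * b + c * (n * (2 * α))) * Real.exp ‖z‖ * (M * Real.exp (α * √t * ‖z‖)) := by
          gcongr
      _ = _ := by rw [show (α * √t + 1) * ‖z‖ = α * √t * ‖z‖ + ‖z‖ by ring, Real.exp_add]; ring
  · refine ae_of_all _ fun z σ hσ => ?_
    exact (qpath_deriv hb ⟨hσ.1, by linarith [hσ.2]⟩ x z).smul_const _

lemma qq_EB {b s T α : ℝ} (hb : 0 ≤ b) (hs : 0 ≤ s) (hsT : s ≤ T) (hα : 0 ≤ α) :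
    EB ((2 * (1 + b * T)) ^ α) α (fun y : E n => qq b y s ^ α) := by
  intro y
  have h0 := one_le_qq hb hs y
  rw [abs_of_nonneg (Real.rpow_nonneg (by linarith) _)]
  exact qq_rpow_le hb hs hsT hα y

lemma Iav_mono {f g : E n → ℝ} (hf : Continuous f) (hg : Continuous g) {C D κ κ' : ℝ} (hκ : 0 ≤ κ) (hκ' : 0 ≤ κ')
    (hfb : EB C κ f) (hgb : EB D κ' g) (hfg : ∀ y, f y ≤ g y) (x : E n) (r : ℝ) :
    Iav (gam n) f x r ≤ Iav (gam n) g x r := by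
  refine integral_mono (integrable_Iav (AD_gam n) (gam_cont n) hf hκ hfb x r)
    (integrable_Iav (AD_gam n) (gam_cont n) hg hκ' hgb x r) fun z => ?_
  exact mul_le_mul_of_nonneg_right (hfg _) (gam_pos n z).le

/-- upper barrier -/
lemma upper_barrier {α b t : ℝ} (hb : 0 ≤ b) (hα : 0 ≤ α) (ht : 0 < t)
    (hG : ∀ (y : E n), ∀ s, 0 ≤ s → 0 ≤ qG α b y s) (x : E n) :
    Iav (gam n) (fun y => (1 + ‖y‖ ^ 2) ^ α) x √t ≤ qq b x t ^ α := by
  have hm : MonotoneOn (qphi α b x t) (Icc 0 t) := by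
    refine monotoneOn_of_deriv_nonneg (convex_Icc 0 t) (qphi_cont hb hα x) ?_ ?_
    · rw [interior_Icc]
      exact fun s hs => (qphi_deriv hb hα hs x).differentiableAt.differentiableWithinAt
    · rw [interior_Icc]
      intro s hs
      rw [(qphi_deriv hb hα hs x).deriv]
      exact integral_nonneg fun z => mul_nonneg (hG _ s hs.1.le) (gam_pos n z).le
  have := hm (left_mem_Icc.2 ht.le) (right_mem_Icc.2 ht.le) ht.le
  simpa [qphi, Iav_zero, qq] using this

lemma qG_upper {α b : ℝ} (hα : 0 ≤ α) (hb0 : 0 ≤ b) (hb : α ≤ 1 → b = 2 * n) (hb' : 1 < α → b = 2 * ((n : ℝ) + 2 * α - 2))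
    (y : E n) (s : ℝ) (hs : 0 ≤ s) : 0 ≤ qG α b y s := by
  have h0 := one_le_qq hb0 hs y
  have h1 : 0 ≤ qq b y s ^ (α - 2) := Real.rpow_nonneg (by linarith) _
  have h2 := sq_le_qq hb0 hs y
  rw [qG_eq, ← qq_rpow_sub_two hb0 hs]
  set P := qq b y s ^ (α - 2)
  set Q := qq b y s
  have hP : 0 ≤ α * P := mul_nonneg hα h1
  rcases le_or_gt α 1 with h | h
  · have e : α * b * (P * Q) - (2 * α * n * (P * Q) + 4 * α * (α - 1) * P * ‖y‖ ^ 2) =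
        α * P * ((b - 2 * n) * Q + 4 * (1 - α) * ‖y‖ ^ 2) := by ring
    rw [e, hb h, sub_self, zero_mul, zero_add]
    have : 0 ≤ 1 - α := by linarith
    positivity
  · have e : α * b * (P * Q) - (2 * α * n * (P * Q) + 4 * α * (α - 1) * P * ‖y‖ ^ 2) =
        α * P * ((b - 2 * ((n : ℝ) + 2 * α - 2)) * Q + 4 * (α - 1) * (Q - ‖y‖ ^ 2)) := by ring
    rw [e, hb' h, sub_self, zero_mul, zero_add]
    have : 0 ≤ α - 1 := by linarith
    have : 0 ≤ Q - ‖y‖ ^ 2 := by linarith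
    positivity

lemma qG_lower {α ε ν A b : ℝ} (hν : 0 < ν) (hα : 1 / (1 + ν) ≤ α) (hα1 : α < 1) (hdim : 0 < (n : ℝ) + 2 * α - 2)
    (hε : 0 < ε) (hε1 : ε < 1) (hA : A = (2 * α * (1 - ε) * ((n : ℝ) + 2 * α - 2)) ^ (-(1 / (1 + ν))))
    (hb : b = 2 * ((n : ℝ) + 2 * α - 2) * ε) (y : E n) (s : ℝ) (hs : 0 ≤ s) :
    A * qG α b y s ≤ - (A * qq b y s ^ α) ^ (-ν) := by
  have hν1 : 0 < 1 + ν := by linarith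
  have hα0 : 0 < α := lt_of_lt_of_le (by positivity) hα
  have hb0 : 0 ≤ b := by rw [hb]; positivity
  have h0 := one_le_qq hb0 hs y
  have h1 : 0 ≤ qq b y s ^ (α - 2) := Real.rpow_nonneg (by linarith) _
  have h2 := sq_le_qq hb0 hs y
  set D := 2 * α * (1 - ε) * ((n : ℝ) + 2 * α - 2) with hD
  have hD0 : 0 < D := by
    have : 0 < 1 - ε := by linarith
    positivity
  have hA0 : 0 < A := by rw [hA]; positivity
  have hAD : A ^ (-ν) = A * D := by
    have e : A * D = D ^ (-(1 / (1 + ν)) + 1) := by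
      rw [Real.rpow_add hD0, Real.rpow_one, hA]
    rw [e, hA, ← Real.rpow_mul hD0.le]
    congr 1
    field_simp; ring
  rw [Real.mul_rpow hA0.le (Real.rpow_nonneg (by linarith) _), hAD, ← Real.rpow_mul (by linarith)]
  have h3 : qq b y s ^ (α * -ν) ≤ qq b y s ^ (α - 1) := by
    apply Real.rpow_le_rpow_of_exponent_le h0
    rw [div_le_iff₀ hν1] at hα
    nlinarith
  have h4 : qG α b y s ≤ - (D * qq b y s ^ (α - 1)) := by
    rw [qG_eq, ← qq_rpow_sub_two hb0 hs]
    set P := qq b y s ^ (α - 2)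
    set Q := qq b y s
    have hP : 0 ≤ α * P := mul_nonneg hα0.le h1
    have e : - (D * (P * Q)) - (α * b * (P * Q) - (2 * α * n * (P * Q) + 4 * α * (α - 1) * P * ‖y‖ ^ 2)) =
        α * P * (4 * (1 - α) * (Q - ‖y‖ ^ 2)) := by rw [hD, hb]; ring
    have : 0 ≤ 1 - α := by linarith
    have : 0 ≤ Q - ‖y‖ ^ 2 := by linarith
    have : 0 ≤ α * P * (4 * (1 - α) * (Q - ‖y‖ ^ 2)) := by positivity
    linarith
  calc A * qG α b y s ≤ A * (- (D * qq b y s ^ (α - 1))) := by gcongr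
    _ = -(A * D * qq b y s ^ (α - 1)) := by ring
    _ ≤ _ := by
      have : 0 ≤ A * D := by positivity
      gcongr

lemma qG_EB {b s T α : ℝ} (hb : 0 ≤ b) (hs : 0 ≤ s) (hsT : s ≤ T) (hα : 0 ≤ α) :
    EB ((α * b + n * (2 * α + 4 * α * |α - 1|)) * (2 * (1 + b * T)) ^ α) α (fun y : E n => qG α b y s) := by
  intro y
  have h0 := one_le_qq hb hs y
  have h1 : 0 ≤ qq b y s ^ (α - 1) := Real.rpow_nonneg (by linarith) _
  simp only [qG]
  refine (abs_sub _ _).trans ?_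
  have h2 : |∑ i, qiD α b i y s (ee i)| ≤ n * ((2 * α + 4 * α * |α - 1|) * qq b y s ^ α) := by
    refine (Finset.abs_sum_le_sum_abs _ _).trans ?_
    calc _ ≤ ∑ i : Fin n, (2 * α + 4 * α * |α - 1|) * qq b y s ^ α := by
          refine Finset.sum_le_sum fun i _ => ?_
          refine le_trans ?_ (norm_qiD_le hb hs hα i y)
          simpa using (qiD α b i y s).le_opNorm (ee i)
      _ = _ := by simp
  rw [abs_of_nonneg (by positivity)]
  calc _ ≤ α * b * qq b y s ^ α + n * ((2 * α + 4 * α * |α - 1|) * qq b y s ^ α) := by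
        refine add_le_add (mul_le_mul_of_nonneg_left ?_ (by positivity)) h2
        exact Real.rpow_le_rpow_of_exponent_le h0 (by linarith)
    _ = (α * b + n * (2 * α + 4 * α * |α - 1|)) * qq b y s ^ α := by ring
    _ ≤ _ := by
      rw [mul_assoc _ ((2 * (1 + b * T)) ^ α)]
      exact mul_le_mul_of_nonneg_left (qq_rpow_le hb hs hsT hα y) (by positivity)

lemma rpow_neg_le {ν A a : ℝ} (hν : 0 < ν) (hA : 0 < A) (h : A ≤ a) : a ^ (-ν) ≤ A ^ (-ν) :=
  Real.rpow_le_rpow_of_nonpos hA h (by linarith)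

lemma HC_of_lower {U : E n → ℝ → ℝ} {A ν : ℝ} (hν : 0 < ν) (hA : 0 < A)
    (hU : ContinuousOn (fun p : E n × ℝ => U p.1 p.2) (univ ×ˢ Ioi 0)) (hl : ∀ y, ∀ s, 0 < s → A ≤ U y s)
    (T : ℝ) {κ : ℝ} (hκ : 0 ≤ κ) : HC T (A ^ (-ν) * √T) κ (fun y s => U y s ^ (-ν)) where
  cont := by
    refine ContinuousOn.rpow_const (hU.mono (prod_mono_right fun s hs => hs.1)) fun p hp => Or.inl ?_
    exact (hA.trans_le (hl _ _ hp.2.1)).ne'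
  bd := by
    intro y s hs
    have h1 := hl y s hs.1
    rw [abs_of_nonneg (Real.rpow_nonneg (by linarith) _)]
    have h2 : 1 ≤ √T * (√s)⁻¹ := by
      rw [← div_eq_mul_inv, one_le_div (Real.sqrt_pos.2 hs.1)]
      exact Real.sqrt_le_sqrt hs.2.le
    have h3 : 1 ≤ Real.exp (κ * ‖y‖) := Real.one_le_exp (by positivity)
    have h4 : 0 ≤ A ^ (-ν) := by positivity
    calc U y s ^ (-ν) ≤ A ^ (-ν) * (1 * 1) := by simpa using rpow_neg_le hν hA h1
      _ ≤ A ^ (-ν) * ((√T * (√s)⁻¹) * Real.exp (κ * ‖y‖)) := by gcongr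
      _ = _ := by ring

/-- lower barrier -/
lemma lower_barrier {α b A ν t : ℝ} (hb : 0 ≤ b) (hα : 0 ≤ α) (ht : 0 < t) (hA : 0 < A) (hν : 0 < ν)
    (hG : ∀ (y : E n), ∀ s, 0 ≤ s → A * qG α b y s ≤ - (A * qq b y s ^ α) ^ (-ν)) (x : E n) :
    A * qq b x t ^ α ≤ A * Iav (gam n) (fun y => (1 + ‖y‖ ^ 2) ^ α) x √t -
      Wop (fun y s => (A * qq b y s ^ α) ^ (-ν)) x t := by
  have hlow : ∀ (y : E n), ∀ s, 0 < s → A ≤ A * qq b y s ^ α := fun y s hs =>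
    le_mul_of_one_le_right hA.le (Real.one_le_rpow (one_le_qq hb hs.le y) hα)
  have H : HC (t + 1) _ 0 (fun (y : E n) s => (A * qq b y s ^ α) ^ (-ν)) :=
    HC_of_lower hν hA (continuousOn_const.mul ((qq_cont_rpow (n := n) hb α).mono (prod_mono_right Ioi_subset_Ici_self))) hlow (t + 1) le_rfl
  obtain ⟨C', hK⟩ := H.KC_W le_rfl
  have hK_int := hK.integrableOn x (t := t) ⟨ht, by linarith⟩
  have hmain := intervalIntegral.sub_le_integral_of_hasDeriv_right_of_le (a := 0) (b := t)
    (g := fun s => A * qphi α b x t s) (g' := fun s => A * Iav (gam n) (fun y => qG α b y s) x √(t - s))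
    (φ := fun s => - Iav (gam n) (fun y => (A * qq b y s ^ α) ^ (-ν)) x √(t - s)) ht.le
    ((qphi_cont hb hα x).const_smul A) (fun s hs => ((qphi_deriv hb hα hs x).const_mul A).hasDerivWithinAt)
    (by rw [integrableOn_Icc_iff_integrableOn_Ioo]; exact hK_int.neg) ?_
  · rw [intervalIntegral.integral_of_le ht.le, integral_Ioc_eq_integral_Ioo, integral_neg] at hmain
    have e1 : qphi α b x t t = qq b x t ^ α := by simp [qphi, Iav_zero]
    have e2 : qphi α b x t 0 = Iav (gam n) (fun y => (1 + ‖y‖ ^ 2) ^ α) x √t := by simp [qphi, qq]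
    simp only [e1, e2] at hmain
    rw [Wop, Jt]
    linarith
  · intro s hs
    have hs' : s ∈ Ioo 0 (t + 1) := ⟨hs.1, by linarith [hs.2]⟩
    have i1 := (integrable_Iav (AD_gam n) (gam_cont n) (qG_slice (n := n) (α := α) hb hs.1.le) hα (qG_EB hb hs.1.le hs.2.le hα) x √(t - s)).const_mul A
    have i2 := (integrable_Iav (AD_gam n) (gam_cont n) (H.slice hs') le_rfl (H.EB hs') x √(t - s)).neg
    simp only [Iav]
    rw [← integral_const_mul, ← integral_neg]
    refine integral_mono i1 i2 fun z => ?_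
    have := mul_le_mul_of_nonneg_right (hG (x + √(t - s) • z) s hs.1.le) (gam_pos n z).le
    simp only [smul_eq_mul, Pi.neg_apply]
    linarith

end

end

section
section
variable {n : ℕ} {F : Type*} [NormedAddCommGroup F] [NormedSpace ℝ F]

lemma HC_const {C κ : ℝ} {h : E n → ℝ} (hh : Continuous h) (hb : EB C κ h) : HC 1 C κ (fun y _ => h y) where
  cont := by fun_prop
  bd := by
    intro y s hs
    refine (hb y).trans ?_
    have h1 : 1 ≤ (√s)⁻¹ := by
      rw [one_le_inv₀ (Real.sqrt_pos.2 hs.1)]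
      exact Real.sqrt_le_one.2 hs.2.le
    have := hb.C_nonneg
    calc C * rexp (κ * ‖y‖) = C * 1 * rexp (κ * ‖y‖) := by ring
      _ ≤ _ := by gcongr

lemma Iav_cont2 {C κ : ℝ} (hκ : 0 ≤ κ) {h : E n → ℝ} (hh : Continuous h) (hb : EB C κ h)
    {η : E n → F} (had : AD η) (hη : Continuous η) : Continuous (fun p : E n × ℝ => Iav η h p.1 p.2) := by
  rw [← continuousOn_univ]
  exact (Iav_continuousOn hκ (HC_const hh hb) had hη).comp (f := fun p : E n × ℝ => (p.1, p.2, (1/2 : ℝ)))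
    (by fun_prop) (fun p _ => ⟨mem_univ _, mem_univ _, by norm_num⟩)

lemma contOn_Ioi {X : Type*} [TopologicalSpace X] {G : E n × ℝ → X} (h : ∀ T, 0 < T → ContinuousOn G (univ ×ˢ Ioo 0 T)) :
    ContinuousOn G (univ ×ˢ Ioi 0) := by
  intro p hp
  have hp2 : 0 < p.2 := hp.2
  have h1 := h (p.2 + 1) (by linarith) p ⟨mem_univ _, hp.2, by linarith⟩
  refine (h1.continuousAt ?_).continuousWithinAt
  exact (isOpen_univ.prod isOpen_Ioo).mem_nhds ⟨mem_univ _, hp.2, by linarith⟩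

lemma W_mono {T C D κ κ' : ℝ} (hκ : 0 ≤ κ) (hκ' : 0 ≤ κ') {g h : E n → ℝ → ℝ} (Hg : HC T C κ g) (Hh : HC T D κ' h)
    {t : ℝ} (ht : t ∈ Ioo 0 T) (hgh : ∀ y, ∀ s ∈ Ioo 0 t, g y s ≤ h y s) (x : E n) : Wop g x t ≤ Wop h x t := by
  obtain ⟨_, hg⟩ := Hg.KC_W hκ
  obtain ⟨_, hh⟩ := Hh.KC_W hκ'
  refine setIntegral_mono_on (hg.integrableOn x ht) (hh.integrableOn x ht) measurableSet_Ioo fun s hs => ?_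
  have hs' : s ∈ Ioo 0 T := ⟨hs.1, hs.2.trans ht.2⟩
  exact Iav_mono (Hg.slice hs') (Hh.slice hs') hκ hκ' (Hg.EB hs') (Hh.EB hs') (fun y => hgh y s hs) x _

lemma W_diff {T C D κ κ' : ℝ} (hκ : 0 ≤ κ) (hκ' : 0 ≤ κ') {g h : E n → ℝ → ℝ} (Hg : HC T C κ g) (Hh : HC T D κ' h)
    {t : ℝ} (ht : t ∈ Ioo 0 T) {d : ℝ → ℝ} (hd : IntegrableOn d (Ioo 0 t))
    (hgh : ∀ y, ∀ s ∈ Ioo 0 t, |g y s - h y s| ≤ d s) (x : E n) : |Wop g x t - Wop h x t| ≤ ∫ s in Ioo 0 t, d s := by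
  obtain ⟨_, hg⟩ := Hg.KC_W hκ
  obtain ⟨_, hh⟩ := Hh.KC_W hκ'
  rw [Wop, Wop, Jt, Jt, ← integral_sub (hg.integrableOn x ht) (hh.integrableOn x ht)]
  refine norm_integral_le_of_norm_le (G := ℝ) hd ((ae_restrict_iff' measurableSet_Ioo).2 (ae_of_all _ fun s hs => ?_))
  have hs' : s ∈ Ioo 0 T := ⟨hs.1, hs.2.trans ht.2⟩
  have i1 := integrable_Iav (AD_gam n) (gam_cont n) (Hg.slice hs') hκ (Hg.EB hs') x √(t - s)
  have i2 := integrable_Iav (AD_gam n) (gam_cont n) (Hh.slice hs') hκ' (Hh.EB hs') x √(t - s)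
  have i3 := (AD_gam n).integrable_exp (gam_cont n) 0
  rw [Iav, Iav, ← integral_sub i1 i2]
  have e : d s = ∫ z, d s * gam n z := by rw [integral_const_mul, integral_gam, mul_one]
  rw [e]
  refine norm_integral_le_of_norm_le ?_ (ae_of_all _ fun z => ?_)
  · refine (i3.const_mul (d s)).congr (ae_of_all _ fun z => ?_)
    simp [abs_of_pos (gam_pos n z)]
  · rw [← sub_smul, norm_smul, Real.norm_eq_abs, Real.norm_eq_abs, abs_of_pos (gam_pos n z)]
    exact mul_le_mul_of_nonneg_right (hgh _ s hs) (gam_pos n z).le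

def Phi (ν : ℝ) (u₀ : E n → ℝ) (U : E n → ℝ → ℝ) (x : E n) (t : ℝ) : ℝ :=
  Iav (gam n) u₀ x √t - Wop (fun y s => U y s ^ (-ν)) x t

structure Setup (ν A C κ : ℝ) (u₀ : E n → ℝ) (pl pu : E n → ℝ → ℝ) : Prop where
  hν : 0 < ν
  hA : 0 < A
  hκ : 0 ≤ κ
  cont0 : Continuous u₀
  eb : EB C κ u₀
  lcont : ContinuousOn (fun p : E n × ℝ => pl p.1 p.2) (univ ×ˢ Ioi 0)
  low : ∀ x t, 0 < t → A ≤ pl x t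
  sub : ∀ x t, 0 < t → pl x t ≤ Phi ν u₀ pl x t
  sup : ∀ x t, 0 < t → Iav (gam n) u₀ x √t ≤ pu x t

variable {ν A C κ : ℝ} {u₀ : E n → ℝ} {pl pu : E n → ℝ → ℝ}

/-- admissible iterates -/
structure Adm (pl pu U : E n → ℝ → ℝ) : Prop where
  cont : ContinuousOn (fun p : E n × ℝ => U p.1 p.2) (univ ×ˢ Ioi 0)
  lo : ∀ x t, 0 < t → pl x t ≤ U x t
  up : ∀ x t, 0 < t → U x t ≤ pu x t

lemma Setup.HC (S : Setup ν A C κ u₀ pl pu) {U : E n → ℝ → ℝ} 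
    (hU : ContinuousOn (fun p : E n × ℝ => U p.1 p.2) (univ ×ˢ Ioi 0))
    (hl : ∀ x t, 0 < t → pl x t ≤ U x t) (T : ℝ) : HC T (A ^ (-ν) * √T) 0 (fun y s => U y s ^ (-ν)) :=
  HC_of_lower S.hν S.hA hU (fun y s hs => (S.low y s hs).trans (hl y s hs)) T le_rfl

lemma W_nonneg {g : E n → ℝ → ℝ} {t : ℝ} (hg : ∀ y, ∀ s ∈ Ioo 0 t, 0 ≤ g y s) (x : E n) : 0 ≤ Wop g x t := by
  refine setIntegral_nonneg measurableSet_Ioo fun s hs => ?_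
  exact integral_nonneg fun z => mul_nonneg (hg _ s hs) (gam_pos n z).le

lemma Setup.Phi_le (S : Setup ν A C κ u₀ pl pu) {U : E n → ℝ → ℝ} 
    (hl : ∀ x t, 0 < t → pl x t ≤ U x t) (x : E n) (t : ℝ) (ht : 0 < t) : Phi ν u₀ U x t ≤ pu x t := by
  have h1 := S.sup x t ht
  have h2 : 0 ≤ Wop (fun y s => U y s ^ (-ν)) x t := W_nonneg (fun y s hs => Real.rpow_nonneg
    ((S.hA.le.trans (S.low y s hs.1)).trans (hl y s hs.1)) _) x
  rw [Phi]; linarith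

lemma Setup.adm0 (S : Setup ν A C κ u₀ pl pu) : Adm pl pu pl :=
  ⟨S.lcont, fun _ _ _ => le_rfl, fun x t ht => (S.sub x t ht).trans (S.Phi_le (fun _ _ _ => le_rfl) x t ht)⟩

lemma Setup.adm_Phi (S : Setup ν A C κ u₀ pl pu) {U : E n → ℝ → ℝ} (hU : Adm pl pu U) : Adm pl pu (Phi ν u₀ U) where
  cont := by
    refine ContinuousOn.sub ?_ (contOn_Ioi fun T hT => W_cont le_rfl (S.HC hU.cont hU.lo T))
    exact ((Iav_cont2 S.hκ S.cont0 S.eb (AD_gam n) (gam_cont n)).comp (f := fun p : E n × ℝ => (p.1, √p.2))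
      (by fun_prop)).continuousOn
  lo := by
    intro x t ht
    refine (S.sub x t ht).trans (sub_le_sub_left ?_ _)
    refine W_mono le_rfl le_rfl (S.HC hU.cont hU.lo (t+1)) (S.HC S.lcont (fun _ _ _ => le_rfl) (t+1))
      ⟨ht, by linarith⟩ (fun y s hs => ?_) x
    exact rpow_neg_le S.hν (S.hA.trans_le (S.low y s hs.1)) (hU.lo y s hs.1)
  up := S.Phi_le hU.lo

lemma rpow_neg_lip {a b : ℝ} (hν : 0 < ν) (hA : 0 < A) (ha : A ≤ a) (hb : A ≤ b) :
    |a ^ (-ν) - b ^ (-ν)| ≤ ν * A ^ (-ν - 1) * |a - b| := by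
  have := (convex_Ici A).norm_image_sub_le_of_norm_hasDerivWithin_le (f := fun u : ℝ => u ^ (-ν))
    (f' := fun u => (-ν) * u ^ (-ν - 1)) (C := ν * A ^ (-ν - 1)) (x := b) (y := a) ?_ ?_ hb ha
  · simpa using this
  · intro u hu
    exact (Real.hasDerivAt_rpow_const (Or.inl (hA.trans_le hu).ne')).hasDerivWithinAt
  · intro u hu
    have h0 : 0 < u := hA.trans_le hu
    rw [norm_mul, norm_neg, Real.norm_eq_abs, abs_of_pos hν, Real.norm_eq_abs, abs_of_pos (by positivity)]
    gcongr ?_ * ?_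
    exact Real.rpow_le_rpow_of_nonpos hA hu (by linarith)

lemma Setup.Phi_diff (S : Setup ν A C κ u₀ pl pu) {U V : E n → ℝ → ℝ}  (hU : Adm pl pu U) (hV : Adm pl pu V)
    {t : ℝ} (ht : 0 < t) {d : ℝ → ℝ} (hd : Continuous d) (h : ∀ y, ∀ s ∈ Ioo 0 t, |U y s - V y s| ≤ d s) (x : E n) :
    |Phi ν u₀ U x t - Phi ν u₀ V x t| ≤ ν * A ^ (-ν - 1) * ∫ s in (0:ℝ)..t, d s := by
  have h1 := W_diff le_rfl le_rfl (S.HC hU.cont hU.lo (t+1)) (S.HC hV.cont hV.lo (t+1))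
    ⟨ht, by linarith⟩ (d := fun s => ν * A ^ (-ν - 1) * d s) ?_ (fun y s hs => ?_) x
  · rw [integral_const_mul, ← integral_Ioc_eq_integral_Ioo, ← intervalIntegral.integral_of_le ht.le] at h1
    refine le_trans (le_of_eq ?_) h1
    rw [Phi, Phi, ← abs_neg]; congr 1; ring
  · exact (Continuous.integrableOn_Icc (by fun_prop)).mono_set Ioo_subset_Icc_self
  · have h2 := S.low y s hs.1
    refine (rpow_neg_lip S.hν S.hA (h2.trans (hU.lo y s hs.1)) (h2.trans (hV.lo y s hs.1))).trans ?_
    have := S.hν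
    have := S.hA
    gcongr
    exact h y s hs

def Uit (ν : ℝ) (u₀ : E n → ℝ) (pl : E n → ℝ → ℝ) : ℕ → E n → ℝ → ℝ
  | 0 => pl
  | k + 1 => Phi ν u₀ (Uit ν u₀ pl k)

lemma Setup.adm_it (S : Setup ν A C κ u₀ pl pu) (k : ℕ) : Adm pl pu (Uit ν u₀ pl k) := by
  induction k with
  | zero => exact S.adm0
  | succ k ih => exact S.adm_Phi ih

lemma Setup.it_diff (S : Setup ν A C κ u₀ pl pu) (k : ℕ) (x : E n) (t : ℝ) (ht : 0 < t) :
    |Uit ν u₀ pl (k + 2) x t - Uit ν u₀ pl (k + 1) x t| ≤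
      A ^ (-ν) * (ν * A ^ (-ν - 1)) ^ k / (k + 1).factorial * t ^ (k + 1) := by
  induction k generalizing x t with
  | zero =>
    have hM : ∀ k (y : E n) s, 0 < s → 0 ≤ Uit ν u₀ pl k y s ^ (-ν) ∧ Uit ν u₀ pl k y s ^ (-ν) ≤ A ^ (-ν) := by
      intro k y s hs
      have h1 := (S.low y s hs).trans ((S.adm_it k).lo y s hs)
      exact ⟨Real.rpow_nonneg (S.hA.le.trans h1) _, rpow_neg_le S.hν S.hA h1⟩
    have h1 := W_diff le_rfl le_rfl (S.HC (S.adm_it 1).cont (S.adm_it 1).lo (t+1)) (S.HC (S.adm_it 0).cont (S.adm_it 0).lo (t+1))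
      ⟨ht, by linarith⟩ (d := fun s => A ^ (-ν)) (by simp) (fun y s hs => ?_) x
    · simp at h1
      rw [max_eq_left ht.le] at h1
      simp
      refine le_trans (le_of_eq ?_) (h1.trans (le_of_eq (mul_comm _ _)))
      change |Phi ν u₀ (Uit ν u₀ pl 1) x t - Phi ν u₀ (Uit ν u₀ pl 0) x t| = _
      rw [Phi, Phi, ← abs_neg]; congr 1; ring
    · have h2 := hM 1 y s hs.1
      have h3 := hM 0 y s hs.1
      rw [abs_le]; constructor <;> linarith
  | succ k ih =>
    have h1 := S.Phi_diff (S.adm_it (k+2)) (S.adm_it (k+1)) ht 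
      (d := fun t => A ^ (-ν) * (ν * A ^ (-ν - 1)) ^ k / (k + 1).factorial * t ^ (k + 1)) (by fun_prop)
      (fun y s hs => ih y s hs.1) x
    refine h1.trans (le_of_eq ?_)
    rw [intervalIntegral.integral_const_mul, integral_pow, Nat.factorial_succ (k+1)]
    push_cast
    field_simp
    simp
    rw [pow_succ (ν * A ^ (-ν - 1))]
    ring

theorem Setup.exists_fixed (S : Setup ν A C κ u₀ pl pu) : ∃ u : E n → ℝ → ℝ, Adm pl pu u ∧
    ∀ x t, 0 < t → u x t = Phi ν u₀ u x t := by
  set D : ℕ → E n × ℝ → ℝ := fun k p => Uit ν u₀ pl (k + 2) p.1 p.2 - Uit ν u₀ pl (k + 1) p.1 p.2 with hD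
  set L := ν * A ^ (-ν - 1) with hL
  have hL0 : 0 < L := by have := S.hν; have := S.hA; positivity
  have hM0 : 0 < A ^ (-ν) := by have := S.hA; positivity
  have hsum : ∀ T, 0 < T → Summable (fun k : ℕ => A ^ (-ν) * L ^ k / (k + 1).factorial * T ^ (k + 1)) := by
    intro T hT
    have h1 := ((Real.summable_pow_div_factorial (L * T)).comp_injective (add_left_injective 1)).mul_left (A ^ (-ν) / L)
    refine h1.congr fun k => ?_
    simp only [Function.comp]
    rw [mul_pow, pow_succ L]
    field_simp
  have hbd : ∀ T, 0 < T → ∀ k, ∀ p ∈ (univ : Set (E n)) ×ˢ Ioo 0 T, ‖D k p‖ ≤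
      A ^ (-ν) * L ^ k / (k + 1).factorial * T ^ (k + 1) := by
    intro T hT k p hp
    refine (S.it_diff k p.1 p.2 hp.2.1).trans ?_
    have := hp.2.1.le
    have := hp.2.2.le
    gcongr
  set u : E n → ℝ → ℝ := fun x t => Uit ν u₀ pl 1 x t + ∑' k, D k (x, t) with hu
  have hunif : ∀ T, 0 < T → TendstoUniformlyOn (fun N p => ∑ k ∈ Finset.range N, D k p) (fun p => ∑' k, D k p) atTop
      ((univ : Set (E n)) ×ˢ Ioo 0 T) := fun T hT => tendstoUniformlyOn_tsum_nat (hsum T hT) (hbd T hT)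
  have hpart : ∀ N (x : E n) t, Uit ν u₀ pl 1 x t + ∑ k ∈ Finset.range N, D k (x, t) = Uit ν u₀ pl (N + 1) x t := by
    intro N x t
    have := Finset.sum_range_sub (fun k => Uit ν u₀ pl (k + 1) x t) N
    simp only [hD]
    rw [this]; ring
  have htend : ∀ (x : E n) t, 0 < t → Tendsto (fun N => Uit ν u₀ pl (N + 1) x t) atTop (𝓝 (u x t)) := by
    intro x t ht
    have h1 := (hunif (t+1) (by linarith)).tendsto_at (x := (x, t)) ⟨mem_univ _, ht, by linarith⟩
    have h2 := h1.const_add (Uit ν u₀ pl 1 x t)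
    simpa only [hpart] using h2
  have hadm : Adm pl pu u := by
    refine ⟨?_, fun x t ht => ?_, fun x t ht => ?_⟩
    · refine ContinuousOn.add (S.adm_it 1).cont (contOn_Ioi fun T hT => ?_)
      refine continuousOn_tsum (fun k => ?_) (hsum T hT) (hbd T hT)
      exact ((S.adm_it _).cont.sub (S.adm_it _).cont).mono (prod_mono_right fun s hs => hs.1)
    · exact ge_of_tendsto' (htend x t ht) fun N => (S.adm_it _).lo x t ht
    · exact le_of_tendsto' (htend x t ht) fun N => (S.adm_it _).up x t ht
  refine ⟨u, hadm, fun x t ht => ?_⟩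
  have h2 : Tendsto (fun N => Uit ν u₀ pl (N + 1 + 1) x t) atTop (𝓝 (u x t)) :=
    (htend x t ht).comp (tendsto_add_atTop_nat 1)
  refine tendsto_nhds_unique h2 ?_
  rw [Metric.tendsto_atTop]
  intro e he
  have he' : 0 < e / (2 * (L * t)) := by positivity
  have h3 := Metric.tendstoUniformlyOn_iff.1 (hunif (t+1) (by linarith)) _ he'
  obtain ⟨N₀, hN₀⟩ := eventually_atTop.1 h3
  refine ⟨N₀, fun N hN => ?_⟩
  have h4 := S.Phi_diff (S.adm_it (N+1)) hadm ht (d := fun _ => e / (2 * (L * t))) continuous_const (fun y s hs => ?_) x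
  · rw [Real.dist_eq]
    refine lt_of_le_of_lt h4 ?_
    rw [intervalIntegral.integral_const, smul_eq_mul]
    rw [← hL]
    have : L * ((t - 0) * (e / (2 * (L * t)))) = e / 2 := by field_simp; ring
    rw [this]; linarith
  · have h5 := hN₀ N hN (y, s) ⟨mem_univ _, hs.1, by linarith [hs.2]⟩
    rw [dist_comm, Real.dist_eq] at h5
    rw [← hpart N y s, hu]
    simp only [add_sub_add_left_eq_sub]
    exact h5.le

end

end

section
section
variable {n : ℕ}

def vD (u₀ : E n → ℝ) (x : E n) (t : ℝ) : E n →L[ℝ] ℝ := (-(√t)⁻¹) • Iav (gamD n) u₀ x √t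
def vi (u₀ : E n → ℝ) (i : Fin n) (x : E n) (t : ℝ) : ℝ := (-(√t)⁻¹) • Iav (gami n i) u₀ x √t
def viD (u₀ : E n → ℝ) (i : Fin n) (x : E n) (t : ℝ) : E n →L[ℝ] ℝ :=
  (-(√t)⁻¹) • (-(√t)⁻¹) • Iav (gamiD n i) u₀ x √t

variable {C κ : ℝ} {u₀ : E n → ℝ}

lemma v_hasFDerivAt (hκ : 0 ≤ κ) (h0 : Continuous u₀) (hb : EB C κ u₀) (x : E n) {t : ℝ} (ht : 0 < t) :
    HasFDerivAt (fun x => Iav (gam n) u₀ x √t) (vD u₀ x t) x :=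
  hasFDerivAt_Iav (AD_gam n) AD_gamD gamD_cont hasFDerivAt_gam h0 hκ hb x (Real.sqrt_pos.2 ht)

lemma vD_apply (hκ : 0 ≤ κ) (h0 : Continuous u₀) (hb : EB C κ u₀) (x : E n) (t : ℝ) (i : Fin n) : vD u₀ x t (ee i) = vi u₀ i x t := by
  simp only [vD, vi, smul_apply]
  rw [Iav, ContinuousLinearMap.integral_apply
    (integrable_Iav AD_gamD gamD_cont h0 hκ hb x _), Iav]
  simp only [smul_apply, gamD_apply]

lemma vi_hasFDerivAt (hκ : 0 ≤ κ) (h0 : Continuous u₀) (hb : EB C κ u₀) (i : Fin n) (x : E n) {t : ℝ} (ht : 0 < t) :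
    HasFDerivAt (fun x => vi u₀ i x t) (viD u₀ i x t) x :=
  (hasFDerivAt_Iav (AD_gami i) (AD_gamiD i) (gamiD_cont i) (hasFDerivAt_gami i) h0 hκ hb x (Real.sqrt_pos.2 ht)).fun_const_smul (-(√t)⁻¹)

lemma sqrt_inv_cont (hκ : 0 ≤ κ) (h0 : Continuous u₀) (hb : EB C κ u₀) : ContinuousOn (fun p : E n × ℝ => -(√p.2)⁻¹) (univ ×ˢ Ioi 0) := by
  refine ContinuousOn.neg (ContinuousOn.inv₀ (by fun_prop) fun p hp => ?_)
  exact (Real.sqrt_pos.2 hp.2).ne'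

lemma vD_cont (hκ : 0 ≤ κ) (h0 : Continuous u₀) (hb : EB C κ u₀) : ContinuousOn (fun p : E n × ℝ => vD u₀ p.1 p.2) (univ ×ˢ Ioi 0) := by
  refine ContinuousOn.smul (sqrt_inv_cont hκ h0 hb) ?_
  exact ((Iav_cont2 hκ h0 hb AD_gamD gamD_cont).comp (f := fun p : E n × ℝ => (p.1, √p.2))
      (by fun_prop)).continuousOn

lemma viD_cont (hκ : 0 ≤ κ) (h0 : Continuous u₀) (hb : EB C κ u₀) (i : Fin n) : ContinuousOn (fun p : E n × ℝ => viD u₀ i p.1 p.2) (univ ×ˢ Ioi 0) := by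
  refine ContinuousOn.smul (sqrt_inv_cont hκ h0 hb) (ContinuousOn.smul (sqrt_inv_cont hκ h0 hb) ?_)
  exact ((Iav_cont2 hκ h0 hb (AD_gamiD i) (gamiD_cont i)).comp (f := fun p : E n × ℝ => (p.1, √p.2))
      (by fun_prop)).continuousOn

lemma gami_trace (z : E n) : ∑ i, gamiD n i z (ee i) = -(1/2) * (n * gam n z + gamD n z z) := by
  have h1 : gamD n z z = ∑ i, z i * gami n i z := by
    rw [clm_sum]; simp only [gamD_apply]
  have h2 : ∀ i, gamiD n i z (ee i) = -(1/2) * (gam n z + z i * gami n i z) := by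
    intro i
    simp only [gamiD, add_apply, smul_apply, gamD_apply]
    simp
    ring
  simp only [h2, h1, ← Finset.mul_sum, Finset.sum_add_distrib]
  simp

lemma v_hasDerivAt (hκ : 0 ≤ κ) (h0 : Continuous u₀) (hb : EB C κ u₀) (x : E n) {t : ℝ} (ht : 0 < t) :
    HasDerivAt (fun t => Iav (gam n) u₀ x √t) (∑ i, viD u₀ i x t (ee i)) t := by
  have hr : 0 < √t := Real.sqrt_pos.2 ht
  have h1 := (hasDerivAt_Iav_scale (AD_gam n) AD_gamD gamD_cont hasFDerivAt_gam h0 hκ hb x hr).comp t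
    (Real.hasDerivAt_sqrt ht.ne')
  refine HasDerivAt.congr_deriv (f := fun t => Iav (gam n) u₀ x √t) h1 ?_
  set r := √t with hrd
  have i1 := integrable_Iav (AD_gam n) (gam_cont n) h0 hκ hb x r
  have i2 := integrable_Iav (AD_gamD (n := n)).apply_self (by have := gamD_cont (n := n); fun_prop) h0 hκ hb x r
  have i3 := fun i => integrable_Iav ((AD_gamiD (n := n) i).apply (ee i))
    ((gamiD_cont i).clm_apply continuous_const) h0 hκ hb x r
  have e1 : ∀ i, viD u₀ i x t (ee i) = r⁻¹ * r⁻¹ * Iav (fun z => gamiD n i z (ee i)) u₀ x r := by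
    intro i
    simp only [viD, smul_apply, ← hrd]
    rw [Iav, ContinuousLinearMap.integral_apply
      (integrable_Iav (AD_gamiD i) (gamiD_cont i) h0 hκ hb x _), Iav]
    simp only [smul_apply, smul_eq_mul]
    ring
  have e2 : ∑ i, Iav (fun z => gamiD n i z (ee i)) u₀ x r =
      -(1/2) * (n * Iav (gam n) u₀ x r + Iav (fun z => gamD n z z) u₀ x r) := by
    simp only [Iav]
    rw [← integral_finsetSum _ (fun i _ => i3 i), ← integral_const_mul (n : ℝ), ← integral_add (i1.const_mul _) i2,
      ← integral_const_mul]
    congr 1; ext z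
    rw [← Finset.smul_sum, gami_trace]
    simp only [smul_eq_mul]; ring
  simp only [e1]
  rw [← Finset.mul_sum, e2]
  field_simp

lemma vD_bound (hκ : 0 ≤ κ) (h0 : Continuous u₀) (hb : EB C κ u₀) (T : ℝ) : ∃ K, 0 ≤ K ∧ ∀ x, ∀ t ∈ Ioo 0 T, ‖vD u₀ x t‖ ≤ K * (√t)⁻¹ * Real.exp (κ * ‖x‖) := by
  have hC := hb.C_nonneg
  refine ⟨C * ∫ z, Real.exp (κ * √T * ‖z‖) * ‖gamD n z‖, mul_nonneg hC (integral_nonneg fun z => by positivity), ?_⟩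
  intro x t ht
  have h1 := norm_Iav_le AD_gamD gamD_cont hκ hb x (r := √t) (R := √T)
      (by rw [abs_of_nonneg (Real.sqrt_nonneg _)]; exact Real.sqrt_le_sqrt ht.2.le)
  rw [vD, norm_smul, norm_neg, Real.norm_eq_abs, abs_of_nonneg (by positivity)]
  calc _ ≤ (√t)⁻¹ * _ := mul_le_mul_of_nonneg_left h1 (by positivity)
    _ = _ := by ring

end

section
variable {n : ℕ}

lemma HC.mono {T C C' κ : ℝ} {h : E n → ℝ → ℝ} (H : HC T C κ h) (hC : C ≤ C') : HC T C' κ h :=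
  ⟨H.cont, fun y s hs => (H.bd y s hs).trans (by gcongr)⟩

variable {ν A C κ : ℝ} {u₀ : E n → ℝ} {pl pu u : E n → ℝ → ℝ}

def uD (ν : ℝ) (u₀ : E n → ℝ) (u : E n → ℝ → ℝ) (x : E n) (t : ℝ) : E n →L[ℝ] ℝ :=
  vD u₀ x t - WD (fun y s => u y s ^ (-ν)) x t

def gD (ν : ℝ) (u₀ : E n → ℝ) (u : E n → ℝ → ℝ) (x : E n) (t : ℝ) : E n →L[ℝ] ℝ :=
  (-ν * u x t ^ (-ν - 1)) • uD ν u₀ u x t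

lemma u_hasFDerivAt (S : Setup ν A C κ u₀ pl pu) (hu : Adm pl pu u) (hfix : ∀ x t, 0 < t → u x t = Phi ν u₀ u x t)
    (x : E n) {t : ℝ} (ht : 0 < t) : HasFDerivAt (fun x => u x t) (uD ν u₀ u x t) x := by
  have e : (fun x => u x t) = fun x => Iav (gam n) u₀ x √t - Wop (fun y s => u y s ^ (-ν)) x t := by
    ext x; rw [hfix x t ht, Phi]
  rw [e]
  exact (v_hasFDerivAt S.hκ S.cont0 S.eb x ht).sub
    (W_hasFDerivAt le_rfl (S.HC hu.cont hu.lo (t + 1)) x ⟨ht, by linarith⟩)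

lemma u_HG (S : Setup ν A C κ u₀ pl pu) (hu : Adm pl pu u) (hfix : ∀ x t, 0 < t → u x t = Phi ν u₀ u x t)
    {T : ℝ} (hT : 0 < T) : ∃ C', HG T C' κ (fun y s => u y s ^ (-ν)) (gD ν u₀ u) := by
  have hν := S.hν
  have hA := S.hA
  have hlow : ∀ y s, 0 < s → A ≤ u y s := fun y s hs => (S.low y s hs).trans (hu.lo y s hs)
  have H := HC_of_lower hν hA hu.cont hlow T S.hκ
  obtain ⟨K, hK0, hK⟩ := vD_bound S.hκ S.cont0 S.eb T
  obtain ⟨K', hK'0, hK'⟩ := WD_bound S.hκ hT H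
  have hL : 0 ≤ ν * A ^ (-ν - 1) := by positivity
  refine ⟨A ^ (-ν) * √T + ν * A ^ (-ν - 1) * (K + K' * √T), H.mono (by linarith [mul_nonneg hL (by positivity : 0 ≤ K + K' * √T)]), ?_, ?_, ?_⟩
  · intro y s hs
    have h1 := u_hasFDerivAt S hu hfix y hs.1
    have h2 := (Real.hasDerivAt_rpow_const (p := -ν) (Or.inl (hA.trans_le (hlow y s hs.1)).ne')).comp_hasFDerivAt y h1
    exact h2
  · have h1 : ContinuousOn (fun p : E n × ℝ => -ν * u p.1 p.2 ^ (-ν - 1)) (univ ×ˢ Ioo 0 T) := by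
      refine ContinuousOn.mul continuousOn_const ?_
      refine ContinuousOn.rpow_const (hu.cont.mono (prod_mono_right fun s hs => hs.1)) fun p hp => Or.inl ?_
      exact (hA.trans_le (hlow _ _ hp.2.1)).ne'
    have h2 : ContinuousOn (fun p : E n × ℝ => uD ν u₀ u p.1 p.2) (univ ×ˢ Ioo 0 T) :=
      ((vD_cont S.hκ S.cont0 S.eb).mono (prod_mono_right fun s hs => hs.1)).sub (WD_cont S.hκ H)
    exact h1.smul h2
  · intro y s hs
    have hl := hlow y s hs.1
    have hu0 : 0 < u y s := hA.trans_le hl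
    have h2 : 1 ≤ √T * (√s)⁻¹ := by
      rw [← div_eq_mul_inv, one_le_div (Real.sqrt_pos.2 hs.1)]
      exact Real.sqrt_le_sqrt hs.2.le
    have h3 : ‖uD ν u₀ u y s‖ ≤ (K + K' * √T) * (√s)⁻¹ * Real.exp (κ * ‖y‖) := by
      refine (norm_sub_le _ _).trans ?_
      have h4 : K' * Real.exp (κ * ‖y‖) * 1 ≤ K' * Real.exp (κ * ‖y‖) * (√T * (√s)⁻¹) := by gcongr
      calc _ ≤ K * (√s)⁻¹ * Real.exp (κ * ‖y‖) + K' * Real.exp (κ * ‖y‖) * (√T * (√s)⁻¹) := by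
            refine add_le_add (hK y s hs) ?_
            linarith [hK' y s hs]
        _ = _ := by ring
    rw [gD, norm_smul, norm_mul, norm_neg, Real.norm_eq_abs, abs_of_pos hν, Real.norm_eq_abs, abs_of_pos (by positivity)]
    have h5 : u y s ^ (-ν - 1) ≤ A ^ (-ν - 1) := Real.rpow_le_rpow_of_nonpos hA hl (by linarith)
    calc _ ≤ ν * A ^ (-ν - 1) * ((K + K' * √T) * (√s)⁻¹ * Real.exp (κ * ‖y‖)) := by gcongr
      _ = 0 + ν * A ^ (-ν - 1) * (K + K' * √T) * ((√s)⁻¹ * Real.exp (κ * ‖y‖)) := by ring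
      _ ≤ A ^ (-ν) * √T * ((√s)⁻¹ * Real.exp (κ * ‖y‖)) + ν * A ^ (-ν - 1) * (K + K' * √T) * ((√s)⁻¹ * Real.exp (κ * ‖y‖)) := by
          gcongr; positivity
      _ = _ := by ring

/-- full regularity data on the strip -/
lemma u_reg (S : Setup ν A C κ u₀ pl pu) (hu : Adm pl pu u) (hfix : ∀ x t, 0 < t → u x t = Phi ν u₀ u x t)
    {T : ℝ} (hT : 0 < T) : IsC21 ((univ : Set (E n)) ×ˢ Ioo (0 : ℝ) T) u ∧
    ∀ (x : E n), ∀ t ∈ Ioo (0 : ℝ) T, deriv (u x) t = lap (fun y => u y t) x - u x t ^ (-ν) := by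
  obtain ⟨C', H⟩ := u_HG S hu hfix hT
  have hκ := S.hκ
  have hsub : (univ : Set (E n)) ×ˢ Ioo (0 : ℝ) T ⊆ univ ×ˢ Ioi 0 := prod_mono_right fun s hs => hs.1
  have hfd : ∀ x, ∀ t ∈ Ioo (0 : ℝ) T, fderiv ℝ (fun y => u y t) x = uD ν u₀ u x t := fun x t ht =>
    (u_hasFDerivAt S hu hfix x ht.1).fderiv
  have hi : ∀ x, ∀ t ∈ Ioo (0 : ℝ) T, ∀ i, uD ν u₀ u x t (ee i) = vi u₀ i x t - Wop (fun y s => gD ν u₀ u y s (ee i)) x t := by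
    intro x t ht i
    rw [uD, sub_apply, vD_apply hκ S.cont0 S.eb, WD_apply hκ H.hc x ht, Wi_eq_W hκ H x ht]
  have hij : ∀ x, ∀ t ∈ Ioo (0 : ℝ) T, ∀ i j, pd2 (fun y => u y t) i j x =
      viD u₀ j x t (ee i) - WD (fun y s => gD ν u₀ u y s (ee j)) x t (ee i) := by
    intro x t ht i j
    rw [pd2]
    have e : (fun y => fderiv ℝ (fun y => u y t) y (EuclideanSpace.single j (1 : ℝ))) =
        fun y => vi u₀ j y t - Wop (fun y s => gD ν u₀ u y s (ee j)) y t := by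
      ext y
      rw [hfd y t ht]; exact hi y t ht j
    rw [e, ((vi_hasFDerivAt hκ S.cont0 S.eb j x ht.1).fun_sub (W_hasFDerivAt hκ (H.comp j) x ht)).fderiv]
    rfl
  have ht' : ∀ x, ∀ t ∈ Ioo (0 : ℝ) T, deriv (u x) t =
      ∑ i, viD u₀ i x t (ee i) - (u x t ^ (-ν) + ∑ i, Wi i (fun y s => gD ν u₀ u y s (ee i)) x t) := by
    intro x t ht
    have h1 := (v_hasDerivAt hκ S.cont0 S.eb x ht.1).sub (W_hasDerivAt hκ H x ht)
    have h2 : u x =ᶠ[𝓝 t] ((fun t => Iav (gam n) u₀ x √t) - fun t => Wop (fun y s => u y s ^ (-ν)) x t) := by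
      filter_upwards [Ioi_mem_nhds ht.1] with s hs
      exact hfix x s hs
    exact (h1.congr_of_eventuallyEq h2).deriv
  have cvi := fun i => (viD_cont hκ S.cont0 S.eb i).mono hsub
  have eqn : ∀ (x : E n), ∀ t ∈ Ioo (0 : ℝ) T, deriv (u x) t = lap (fun y => u y t) x - u x t ^ (-ν) := by
    intro x t ht
    rw [ht' x t ht, lap]
    simp only [hij x t ht]
    rw [Finset.sum_sub_distrib]
    simp only [WD_apply hκ (H.comp _) x ht]
    ring
  refine ⟨⟨hu.cont.mono hsub, ?_, fun i => ?_, fun i j => ?_⟩, eqn⟩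
  · refine ContinuousOn.congr (f := fun p : E n × ℝ => ∑ i, viD u₀ i p.1 p.2 (ee i) -
      (u p.1 p.2 ^ (-ν) + ∑ i, Wi i (fun y s => gD ν u₀ u y s (ee i)) p.1 p.2)) ?_ (fun p hp => ht' p.1 p.2 hp.2)
    refine ContinuousOn.sub (continuousOn_finsetSum _ fun i _ => (cvi i).clm_apply continuousOn_const) 
      (ContinuousOn.add H.hc.cont (continuousOn_finsetSum _ fun i _ => Wi_cont hκ (H.comp i) i))
  · refine ContinuousOn.congr (f := fun p : E n × ℝ => uD ν u₀ u p.1 p.2 (ee i)) ?_ (fun p hp => by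
      simp only [hfd p.1 p.2 hp.2])
    exact (((vD_cont hκ S.cont0 S.eb).mono hsub).sub (WD_cont hκ H.hc)).clm_apply continuousOn_const
  · refine ContinuousOn.congr (f := fun p : E n × ℝ => viD u₀ j p.1 p.2 (ee i) - 
      WD (fun y s => gD ν u₀ u y s (ee j)) p.1 p.2 (ee i)) ?_ (fun p hp => hij p.1 p.2 hp.2 i j)
    exact ((cvi j).clm_apply continuousOn_const).sub ((WD_cont hκ (H.comp j)).clm_apply continuousOn_const)

end

end

section final
variable {n : ℕ} {ν A C κ : ℝ} {u₀ : E n → ℝ} {pl pu u : E n → ℝ → ℝ}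

lemma W_small (S : Setup ν A C κ u₀ pl pu) (hu : Adm pl pu u) (x : E n) {t : ℝ} (ht : 0 < t) :
    |Wop (fun y s => u y s ^ (-ν)) x t| ≤ A ^ (-ν) * t := by
  have H := S.HC hu.cont hu.lo (t + 1)
  have H0 : HC (t + 1) 0 0 (fun (_ : E n) (_ : ℝ) => (0 : ℝ)) :=
    ⟨continuousOn_const, fun y s _ => by simp⟩
  have h := W_diff le_rfl le_rfl H H0 (t := t) ⟨ht, by linarith⟩ (d := fun _ => A ^ (-ν))
    (integrableOn_const (by simp)) (fun y s hs => ?_) x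
  · have e : Wop (fun (_ : E n) (_ : ℝ) => (0 : ℝ)) x t = 0 := by simp [Wop, Jt, Iav]
    rw [e, sub_zero] at h
    refine h.trans (le_of_eq ?_)
    rw [setIntegral_const]
    simp [measureReal_def, ht.le, mul_comm]
  · have hA := S.hA
    have hl : A ≤ u y s := (S.low y s hs.1).trans (hu.lo y s hs.1)
    rw [sub_zero, abs_of_nonneg (Real.rpow_nonneg (hA.le.trans hl) _)]
    exact rpow_neg_le S.hν hA hl

lemma u_pointwise (S : Setup ν A C κ u₀ pl pu) (hu : Adm pl pu u)
    (hfix : ∀ x t, 0 < t → u x t = Phi ν u₀ u x t) (x : E n) :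
    Tendsto (fun t => u x t) (𝓝[>] (0 : ℝ)) (𝓝 (u₀ x)) := by
  have h1 : Tendsto (fun t : ℝ => Iav (gam n) u₀ x √t) (𝓝[>] (0 : ℝ)) (𝓝 (u₀ x)) := by
    have hc : Continuous (fun t : ℝ => Iav (gam n) u₀ x √t) :=
      (Iav_cont2 S.hκ S.cont0 S.eb (AD_gam n) (gam_cont n)).comp (f := fun t : ℝ => (x, √t)) (by fun_prop)
    have := hc.tendsto 0
    simp only [Real.sqrt_zero, Iav_zero] at this
    exact this.mono_left nhdsWithin_le_nhds
  have h2 : Tendsto (fun t : ℝ => Wop (fun y s => u y s ^ (-ν)) x t) (𝓝[>] (0 : ℝ)) (𝓝 0) := by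
    refine squeeze_zero_norm' (a := fun t => A ^ (-ν) * t) ?_ ?_
    · filter_upwards [self_mem_nhdsWithin] with t ht
      exact W_small S hu x ht
    · have : Tendsto (fun t : ℝ => A ^ (-ν) * t) (𝓝 0) (𝓝 (A ^ (-ν) * 0)) :=
        (continuous_const.mul continuous_id).tendsto 0
      rw [mul_zero] at this
      exact this.mono_left nhdsWithin_le_nhds
  have h3 := h1.sub h2
  rw [sub_zero] at h3
  refine h3.congr' ?_
  filter_upwards [self_mem_nhdsWithin] with t ht
  exact (hfix x t ht).symm

lemma u_slice (hu : Adm pl pu u) {t : ℝ} (ht : 0 < t) : Continuous (fun x => u x t) := by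
  rw [← continuousOn_univ]
  exact hu.cont.comp (f := fun x : E n => (x, t)) (by fun_prop) fun x _ => ⟨mem_univ _, ht⟩

lemma u_init (S : Setup ν A C κ u₀ pl pu) (hu : Adm pl pu u)
    (hfix : ∀ x t, 0 < t → u x t = Phi ν u₀ u x t) {D : ℝ}
    (hD : ∀ x t, 0 < t → t < 1 → u x t ≤ D * Real.exp (κ * ‖x‖)) (K : Set (E n)) (hK : IsCompact K) :
    Tendsto (fun t => ∫ x in K, |u x t - u₀ x|) (𝓝[>] (0 : ℝ)) (𝓝 0) := by
  have h0 : (0 : ℝ) = ∫ x in K, (0 : ℝ) := by simp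
  suffices h : Tendsto (fun t => ∫ x in K, |u x t - u₀ x|) (𝓝[>] (0 : ℝ)) (𝓝 (∫ x in K, (0 : ℝ))) by
    rwa [← h0] at h
  have hlt : ∀ᶠ t in 𝓝[>] (0 : ℝ), t ∈ Ioo (0 : ℝ) 1 := Ioo_mem_nhdsGT one_pos
  refine tendsto_integral_filter_of_dominated_convergence
    (fun x => D * Real.exp (κ * ‖x‖) + C * Real.exp (κ * ‖x‖)) ?_ ?_ ?_ ?_
  · filter_upwards [hlt] with t ht
    exact ((u_slice hu ht.1).sub S.cont0).abs.aestronglyMeasurable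
  · filter_upwards [hlt] with t ht
    refine ae_of_all _ fun x => ?_
    have hl : 0 ≤ u x t := (S.hA.le.trans (S.low x t ht.1)).trans (hu.lo x t ht.1)
    rw [Real.norm_eq_abs, abs_abs]
    refine (abs_sub _ _).trans ?_
    rw [abs_of_nonneg hl]
    exact add_le_add (hD x t ht.1 ht.2) (S.eb x)
  · exact (Continuous.continuousOn (by fun_prop)).integrableOn_compact hK
  · refine ae_of_all _ fun x => ?_
    have := ((u_pointwise S hu hfix x).sub_const (u₀ x)).abs
    simpa using this

lemma u_repr (hfix : ∀ x t, 0 < t → u x t = Phi ν u₀ u x t) (T : ℝ) : HeatRepr n ν T u₀ u := by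
  intro x t ht
  rw [hfix x t ht.1, Phi, heat_eq_Iav ht.1, Wop, Jt]
  congr 1
  refine setIntegral_congr_fun measurableSet_Ioo fun s hs => ?_
  exact (heat_eq_Iav (sub_pos.2 hs.2) (fun y => u y s ^ (-ν)) x).symm

end final

/-- Existence of a global solution with growth rate bounds and heat-kernel
representation (Theorem 1.5). -/
theorem growth_rate_existence (n : ℕ) (hn : 1 ≤ n) (ν : ℝ) (hν : 0 < ν)
    (α₁ α₂ ε A₁ A₂ b₁ b₂ : ℝ)
    (hα₁ : 1 / (1 + ν) ≤ α₁) (hα₁₂ : α₁ ≤ α₂) (hα₁lt : α₁ < 1)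
    (hdim : 0 < (n : ℝ) + 2 * α₁ - 2) (hε : 0 < ε) (hε1 : ε < 1)
    (hA₁ : A₁ = (2 * α₁ * (1 - ε) * ((n : ℝ) + 2 * α₁ - 2)) ^ (-(1 / (1 + ν))))
    (hA₁₂ : A₁ ≤ A₂)
    (hb₁ : b₁ = 2 * ((n : ℝ) + 2 * α₁ - 2) * ε)
    (hb₂ : α₂ ≤ 1 → b₂ = 2 * n)
    (hb₂' : 1 < α₂ → b₂ = 2 * ((n : ℝ) + 2 * α₂ - 2))
    (u₀ : E n → ℝ) (hu₀c : Continuous u₀)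
    (hu₀l : ∀ x : E n, A₁ * (1 + ‖x‖ ^ 2) ^ α₁ ≤ u₀ x)
    (hu₀u : ∀ x : E n, u₀ x ≤ A₂ * (1 + ‖x‖ ^ 2) ^ α₂) :
    ∃ u : E n → ℝ → ℝ, IsGlobalSol n ν u₀ u ∧
      (∀ (x : E n) (t : ℝ), 0 < t →
        A₁ * (1 + ‖x‖ ^ 2 + b₁ * t) ^ α₁ ≤ u x t ∧
        u x t ≤ A₂ * (1 + ‖x‖ ^ 2 + b₂ * t) ^ α₂) ∧
      ∀ T > (0 : ℝ), HeatRepr n ν T u₀ u := by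
  have hα0 : 0 < α₁ := lt_of_lt_of_le (by positivity) hα₁
  have hα20 : 0 ≤ α₂ := (hα0.le).trans hα₁₂
  have hε' : 0 < 1 - ε := by linarith
  have hA : 0 < A₁ := by rw [hA₁]; positivity
  have hA2 : 0 < A₂ := hA.trans_le hA₁₂
  have hb1 : 0 ≤ b₁ := by rw [hb₁]; positivity
  have hn' : (1 : ℝ) ≤ n := by exact_mod_cast hn
  have hb2 : 0 ≤ b₂ := by
    rcases le_or_gt α₂ 1 with h | h
    · rw [hb₂ h]; positivity
    · rw [hb₂' h]; linarith
  have q0 : ∀ y : E n, qq 0 y 0 = 1 + ‖y‖ ^ 2 := fun y => by simp [qq]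
  have c0 : ∀ β : ℝ, Continuous (fun y : E n => (1 + ‖y‖ ^ 2) ^ β) := fun β => by
    have := qq_slice (n := n) (b := 0) (s := 0) le_rfl le_rfl β
    simpa only [q0] using this
  have eb0 : ∀ β : ℝ, 0 ≤ β → ∀ a : ℝ, 0 < a → EB (a * (2 * (1 + 0 * 0)) ^ β) β (fun y : E n => a * (1 + ‖y‖ ^ 2) ^ β) := by
    intro β hβ a ha y
    have := qq_EB (n := n) (b := 0) (s := 0) (T := 0) le_rfl le_rfl le_rfl hβ y
    simp only [q0] at this
    rw [abs_mul, abs_of_pos ha, mul_assoc]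
    gcongr
  have hu0 : ∀ y, 0 ≤ u₀ y := fun y => le_trans (by positivity) (hu₀l y)
  have ebu : EB (A₂ * (2 * (1 + 0 * 0)) ^ α₂) α₂ u₀ := fun y => by
    rw [abs_of_nonneg (hu0 y)]
    exact (hu₀u y).trans ((le_abs_self _).trans (eb0 α₂ hα20 A₂ hA2 y))
  have hmul : ∀ (a : ℝ) (f : E n → ℝ) (x : E n) (r : ℝ), Iav (gam n) (fun y => a * f y) x r = a * Iav (gam n) f x r := by
    intro a f x r
    simp only [Iav, smul_eq_mul, mul_assoc, integral_const_mul]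
  have S : Setup ν A₁ (A₂ * (2 * (1 + 0 * 0)) ^ α₂) α₂ u₀ (fun x t => A₁ * qq b₁ x t ^ α₁) (fun x t => A₂ * qq b₂ x t ^ α₂) :=
    { hν := hν
      hA := hA
      hκ := hα20
      cont0 := hu₀c
      eb := ebu
      lcont := continuousOn_const.mul ((qq_cont_rpow hb1 α₁).mono (prod_mono_right Ioi_subset_Ici_self))
      low := fun x t ht => le_mul_of_one_le_right hA.le (Real.one_le_rpow (one_le_qq hb1 ht.le x) hα0.le)
      sub := fun x t ht => by
        have h1 := lower_barrier hb1 hα0.le ht hA hν (qG_lower hν hα₁ hα₁lt hdim hε hε1 hA₁ hb₁) x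
        have h2 := Iav_mono (f := fun y => A₁ * (1 + ‖y‖ ^ 2) ^ α₁) (continuous_const.mul (c0 α₁)) hu₀c hα0.le hα20 (eb0 α₁ hα0.le A₁ hA) ebu hu₀l x √t
        rw [hmul] at h2
        rw [Phi]
        linarith
      sup := fun x t ht => by
        have h1 := upper_barrier hb2 hα20 ht (qG_upper hα20 hb2 hb₂ hb₂') x
        have h2 := Iav_mono (g := fun y => A₂ * (1 + ‖y‖ ^ 2) ^ α₂) hu₀c (continuous_const.mul (c0 α₂)) hα20 hα20 ebu (eb0 α₂ hα20 A₂ hA2) hu₀u x √t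
        rw [hmul] at h2
        exact h2.trans (mul_le_mul_of_nonneg_left h1 hA2.le) }
  obtain ⟨u, hu, hfix⟩ := S.exists_fixed
  have hlow : ∀ x t, 0 < t → A₁ ≤ u x t := fun x t ht => (S.low x t ht).trans (hu.lo x t ht)
  have hup : ∀ T : ℝ, ∀ x t, 0 < t → t < T → u x t ≤ A₂ * (2 * (1 + b₂ * T)) ^ α₂ * Real.exp (α₂ * ‖x‖) := by
    intro T x t ht htT
    refine (hu.up x t ht).trans ?_
    rw [mul_assoc]
    exact mul_le_mul_of_nonneg_left (qq_rpow_le hb2 ht.le htT.le hα20 x) hA2.le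
  refine ⟨u, fun T hT => ?_, fun x t ht => ⟨hu.lo x t ht, hu.up x t ht⟩, fun T _ => u_repr hfix T⟩
  obtain ⟨hreg, heqn⟩ := u_reg S hu hfix hT
  refine ⟨fun x t ht => hA.trans_le (hlow x t ht.1), hreg, heqn, fun K hK => u_init S hu hfix (hup 1) K hK, ?_⟩
  intro δ hδ
  have hBT : 0 < 2 * (1 + b₂ * T) := by have := mul_nonneg hb2 hT.le; linarith
  set B := A₂ * (2 * (1 + b₂ * T)) ^ α₂ with hB
  have hB0 : 0 < B := by positivity
  refine ⟨A₁, B * Real.exp α₂ + α₂, hA, by positivity, fun x t ht => ⟨?_, ?_⟩⟩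
  · refine le_trans ?_ (hlow x t ht.1)
    refine mul_le_of_le_one_right hA.le (Real.rpow_le_one_of_one_le_of_nonpos ?_ ?_)
    · nlinarith [sq_nonneg ‖x‖]
    · rw [neg_nonpos]; positivity
  · refine (hup T x t ht.1 (by linarith [ht.2, hδ.1])).trans ?_
    have h1 : ‖x‖ ≤ 1 + ‖x‖ ^ 2 := by nlinarith [sq_nonneg (‖x‖ - 1), sq_nonneg ‖x‖]
    have hE : 0 ≤ B * Real.exp α₂ := by positivity
    calc B * Real.exp (α₂ * ‖x‖) ≤ B * Real.exp (α₂ + α₂ * ‖x‖ ^ 2) := by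
          gcongr; nlinarith
      _ = (B * Real.exp α₂) * Real.exp (α₂ * ‖x‖ ^ 2) := by rw [Real.exp_add]; ring
      _ ≤ (B * Real.exp α₂ + α₂) * Real.exp ((B * Real.exp α₂ + α₂) * ‖x‖ ^ 2) := by
          gcongr
          · linarith
          · linarith
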